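/- On the hexagonal lattice with L ≥ 8, fix a proper partition (A,B) of Ω and for i ≥ 0 let U_i denote the number of nice pairs (σ,ζ) with max{H(σ), H(ζ)} = 2L+i. Then: (1) U_i = 0 for all i ≤ 2; (2) there exists a constant C = C(q) > 0 such that U_i ≤ (CL)^{3i+1} for all i < (√6 − 2)L − 1. -/

import Mathlib

open scoped Classical BigOperators

namespace IsingHex

/-- Sites of the hexagonal lattice of side length `L` with periodic boundary conditions,
identified with the `2L²` triangular faces of the dual triangular lattice `Λ*`:
`(p, false)` is the up-triangle and `(p, true)` the down-triangle in the rhombic cell `p`. -/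
abbrev Site (L : ℕ) : Type := (ZMod L × ZMod L) × Bool

/-- Spin configurations `X = Ω^Λ` with spin set `Ω = Fin q`. -/
abbrev Conf (L q : ℕ) : Type := Site L → Fin q

/-- Adjacency of the hexagonal lattice: the up-triangle `(p, false)` is adjacent to the
down-triangles `(p, true)`, `(p - (1,0), true)` and `(p - (0,1), true)`. -/
def hexAdj {L : ℕ} (v w : Site L) : Prop :=
  (v.2 = false ∧ w.2 = true ∧
     (w.1 = v.1 ∨ w.1 = (v.1.1 - 1, v.1.2) ∨ w.1 = (v.1.1, v.1.2 - 1))) ∨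
  (v.2 = true ∧ w.2 = false ∧
     (v.1 = w.1 ∨ v.1 = (w.1.1 - 1, w.1.2) ∨ v.1 = (w.1.1, w.1.2 - 1)))

/-- The Hamiltonian `H(σ)`: the number of edges of `Λ` whose endpoints carry different
spins; each edge is counted exactly once through its unique up-triangle endpoint. -/
noncomputable def Ham (L q : ℕ) (σ : Conf L q) : ℕ :=
  Nat.card {e : Site L × Site L // e.1.2 = false ∧ hexAdj e.1 e.2 ∧ σ e.1 ≠ σ e.2}

/-- The monochromatic ground state `𝐚`. -/
def groundConf (L q : ℕ) (a : Fin q) : Conf L q := fun _ => a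

/-- The set `S = {𝟏, …, 𝐪}` of ground states. -/
def groundSet (L q : ℕ) : Set (Conf L q) := {σ | ∃ a : Fin q, σ = groundConf L q a}

/-- Partition function `Z_β`. -/
noncomputable def Zfun (L q : ℕ) (β : ℝ) : ℝ :=
  ∑' σ : Conf L q, Real.exp (-β * (Ham L q σ : ℝ))

/-- Gibbs measure of a set of configurations. -/
noncomputable def gibbsP (L q : ℕ) (β : ℝ) (A : Set (Conf L q)) : ℝ :=
  (∑' σ : Conf L q, A.indicator (fun ζ => Real.exp (-β * (Ham L q ζ : ℝ))) σ) / Zfun L q β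

/-- `σ ∼ ζ`: the two configurations differ at exactly one site. -/
def oneFlip {L q : ℕ} (σ ζ : Conf L q) : Prop :=
  ∃ x : Site L, σ x ≠ ζ x ∧ ∀ y : Site L, y ≠ x → σ y = ζ y

/-- Metropolis jump rates `c_β(σ, ζ)`. -/
noncomputable def rate (L q : ℕ) (β : ℝ) (σ ζ : Conf L q) : ℝ :=
  if oneFlip σ ζ then Real.exp (-β * max ((Ham L q ζ : ℝ) - (Ham L q σ : ℝ)) 0) else 0

/-- There is a `t`-path of single spin flips connecting `σ` and `ζ`. -/
def ConnBelow (L q : ℕ) (t : ℕ) (σ ζ : Conf L q) : Prop :=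
  ∃ (N : ℕ) (ω : ℕ → Conf L q), ω 0 = σ ∧ ω N = ζ ∧
    (∀ n < N, oneFlip (ω n) (ω (n + 1))) ∧ ∀ n ≤ N, Ham L q (ω n) ≤ t

/-- Communication height `Φ(σ, ζ)`. -/
noncomputable def commHeight (L q : ℕ) (σ ζ : Conf L q) : ℕ :=
  sInf {t : ℕ | ConnBelow L q t σ ζ}

/-- The strip of index `ℓ` in direction `d` (`0` = horizontal, `1` = vertical,
`2` = diagonal): `2L` consecutive triangles winding around the torus. -/
def stripSet (L : ℕ) (d : Fin 3) (ℓ : ZMod L) : Set (Site L) :=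
  if d = 0 then {v | v.1.2 = ℓ}
  else if d = 1 then {v | v.1.1 = ℓ}
  else {v | (v.2 = false ∧ v.1.1 + v.1.2 = ℓ) ∨ (v.2 = true ∧ v.1.1 + v.1.2 = ℓ - 1)}

/-- Strip energy `ΔH_s(σ)`: number of adjacent pairs inside the strip with different spins. -/
noncomputable def stripEnergy (L q : ℕ) (σ : Conf L q) (d : Fin 3) (ℓ : ZMod L) : ℕ :=
  Nat.card {e : Site L × Site L //
    e.1.2 = false ∧ e.1 ∈ stripSet L d ℓ ∧ e.2 ∈ stripSet L d ℓ ∧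
      hexAdj e.1 e.2 ∧ σ e.1 ≠ σ e.2}

/-- The strip `(d, ℓ)` is an `a`-bridge of `σ`. -/
def IsBridgeWith (L q : ℕ) (σ : Conf L q) (d : Fin 3) (ℓ : ZMod L) (a : Fin q) : Prop :=
  ∀ v ∈ stripSet L d ℓ, σ v = a

/-- The strip `(d, ℓ)` is a bridge of `σ`. -/
def IsBridge (L q : ℕ) (σ : Conf L q) (d : Fin 3) (ℓ : ZMod L) : Prop :=
  ∃ a : Fin q, IsBridgeWith L q σ d ℓ a

/-- Cyclic enumeration of the strip `(d, ℓ)` by `ZMod (2L)`, consecutive triangles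
being adjacent. -/
def stripCycle (L : ℕ) (d : Fin 3) (ℓ : ZMod L) (k : ZMod (2 * L)) : Site L :=
  let t : ZMod L := ((k.val / 2 : ℕ) : ZMod L)
  if d = 0 then ((t, ℓ), decide (k.val % 2 = 1))
  else if d = 1 then ((ℓ, t), decide (k.val % 2 = 1))
  else if k.val % 2 = 1 then ((t, ℓ - 1 - t), true) else ((t, ℓ - t), false)

/-- A set of triangles is an arc (a set of consecutive triangles) of the strip `(d, ℓ)`. -/
def IsArc (L : ℕ) (d : Fin 3) (ℓ : ZMod L) (S : Set (Site L)) : Prop :=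
  ∃ (s : ZMod (2 * L)) (m : ℕ),
    S = (fun k : ℕ => stripCycle L d ℓ (s + (k : ZMod (2 * L)))) '' Set.Iio m

/-- The strip `(d, ℓ)` is an `{a,b}`-semibridge of `σ`: it carries exactly the two
spins `a ≠ b`, and the sites carrying each spin are consecutive in the strip. -/
def IsSemibridgePair (L q : ℕ) (σ : Conf L q) (d : Fin 3) (ℓ : ZMod L) (a b : Fin q) : Prop :=
  a ≠ b ∧ (∀ v ∈ stripSet L d ℓ, σ v = a ∨ σ v = b) ∧
    (∃ v ∈ stripSet L d ℓ, σ v = a) ∧ (∃ v ∈ stripSet L d ℓ, σ v = b) ∧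
    IsArc L d ℓ {v ∈ stripSet L d ℓ | σ v = a} ∧ IsArc L d ℓ {v ∈ stripSet L d ℓ | σ v = b}

/-- The strip `(d, ℓ)` is a semibridge of `σ`. -/
def IsSemibridge (L q : ℕ) (σ : Conf L q) (d : Fin 3) (ℓ : ZMod L) : Prop :=
  ∃ a b : Fin q, IsSemibridgePair L q σ d ℓ a b

/-- `σ` has an `a`-cross: two `a`-bridges in different directions. -/
def HasCross (L q : ℕ) (σ : Conf L q) (a : Fin q) : Prop :=
  ∃ (d d' : Fin 3) (ℓ ℓ' : ZMod L),
    d ≠ d' ∧ IsBridgeWith L q σ d ℓ a ∧ IsBridgeWith L q σ d' ℓ' a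

/-- `σ` is cross-free. -/
def CrossFree (L q : ℕ) (σ : Conf L q) : Prop := ∀ a : Fin q, ¬ HasCross L q σ a

/-- Connected subsets of the torus `𝕋_L` of strip indices (the collection `𝔖_L`). -/
def CircConn (L : ℕ) (P : Set (ZMod L)) : Prop :=
  ∀ x ∈ P, ∀ y ∈ P, ∃ (N : ℕ) (γ : ℕ → ZMod L), γ 0 = x ∧ γ N = y ∧
    (∀ n ≤ N, γ n ∈ P) ∧ ∀ n < N, γ (n + 1) = γ n + 1 ∨ γ (n + 1) = γ n - 1

/-- Union of the strips with indices in `P`, in direction `d`. -/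
def stripUnion (L : ℕ) (d : Fin 3) (P : Set (ZMod L)) : Set (Site L) :=
  ⋃ ℓ ∈ P, stripSet L d ℓ

/-- The configuration `ξ^{a,b}_U`: spin `b` on `U` and spin `a` elsewhere. -/
noncomputable def xiConf (L q : ℕ) (a b : Fin q) (U : Set (Site L)) : Conf L q :=
  fun v => if v ∈ U then b else a

/-- `σ ∈ R_n^{a,b}`: a regular configuration between `𝐚` and `𝐛` built from `n` strips. -/
def IsRegular (L q : ℕ) (σ : Conf L q) (a b : Fin q) (n : ℕ) : Prop :=
  ∃ (d : Fin 3) (P : Set (ZMod L)), CircConn L P ∧ P.ncard = n ∧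
    σ = xiConf L q a b (stripUnion L d P)

/-- The vertices (in the triangular lattice) of the triangle `v`. -/
def triVerts (L : ℕ) (v : Site L) : Set (ZMod L × ZMod L) :=
  if v.2 = false then {v.1, (v.1.1 + 1, v.1.2), (v.1.1, v.1.2 + 1)}
  else {(v.1.1 + 1, v.1.2), (v.1.1, v.1.2 + 1), (v.1.1 + 1, v.1.2 + 1)}

/-- A connected set of triangles (connected through shared sides). -/
def ConnSet (L : ℕ) (U : Set (Site L)) : Prop :=
  ∀ x ∈ U, ∀ y ∈ U, ∃ (N : ℕ) (γ : ℕ → Site L), γ 0 = x ∧ γ N = y ∧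
    (∀ n ≤ N, γ n ∈ U) ∧ ∀ n < N, hexAdj (γ n) (γ (n + 1))

/-- A one-dimensional canonical set inside the strip `(d, ℓ)`. -/
def OneDimCanonical (L : ℕ) (d : Fin 3) (ℓ : ZMod L) (U : Set (Site L)) : Prop :=
  U ⊆ stripSet L d ℓ ∧ U.Nonempty ∧ U ≠ stripSet L d ℓ ∧
  (ConnSet L U ∨
    (Even U.ncard ∧ ∃ (U₁ : Set (Site L)) (y : Site L),
      U = U₁ ∪ {y} ∧ y ∉ U₁ ∧ U₁.Nonempty ∧ ConnSet L U₁ ∧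
      (∀ x ∈ U₁, ¬ hexAdj x y) ∧ ∃ x ∈ U₁, (triVerts L x ∩ triVerts L y).Nonempty))

/-- `P ≺ P'`: connected index sets with `P ⊆ P'` and `|P'| = |P| + 1`. -/
def StepPair (L : ℕ) (P P' : Set (ZMod L)) : Prop :=
  CircConn L P ∧ CircConn L P' ∧ P ⊆ P' ∧ P'.ncard = P.ncard + 1

/-- A protuberance attached to `s(P)` inside the strip `(d, ℓ)`: a one-dimensional
canonical set such that, when `1 ≤ |P| ≤ L-2`, at least half of its triangles share a
side with `s(P)`. -/
def IsProtuberance (L : ℕ) (d : Fin 3) (P : Set (ZMod L)) (ℓ : ZMod L)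
    (U : Set (Site L)) : Prop :=
  OneDimCanonical L d ℓ U ∧
    (1 ≤ P.ncard → P.ncard ≤ L - 2 →
      U.ncard ≤ 2 * {x ∈ U | ∃ y ∈ stripUnion L d P, hexAdj x y}.ncard)

/-- `‖σ‖_a`: the number of sites with spin `a`. -/
noncomputable def spinCount (L q : ℕ) (σ : Conf L q) (a : Fin q) : ℕ :=
  Nat.card {x : Site L // σ x = a}

/-- `N̂(S)`: configurations connected to a ground state by a `(2L+2)`-path. -/
def NHatGround (L q : ℕ) : Set (Conf L q) :=
  {ζ | ∃ a : Fin q, ConnBelow L q (2 * L + 2) (groundConf L q a) ζ}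

/-- A nice pair of configurations (relative to the partition class `A`). -/
def NicePair (L q : ℕ) (A : Finset (Fin q)) (σ ζ : Conf L q) : Prop :=
  σ ∉ NHatGround L q ∧ ζ ∉ NHatGround L q ∧ oneFlip σ ζ ∧
    (∑ a ∈ A, spinCount L q σ a) = L ^ 2 ∧ (∑ a ∈ A, spinCount L q ζ a) = L ^ 2 - 1

/-- `u` is the vector of mean hitting times `σ ↦ E_σ[τ_A]` of the Metropolis dynamics:
it vanishes on `A` and satisfies the first-step (harmonicity) equations off `A`. -/
def IsMeanHittingTime (L q : ℕ) (β : ℝ) (A : Set (Conf L q)) (u : Conf L q → ℝ) : Prop :=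
  (∀ σ ∈ A, u σ = 0) ∧
    ∀ σ ∉ A, (∑' ζ : Conf L q, rate L q β σ ζ) * u σ =
      1 + ∑' ζ : Conf L q, rate L q β σ ζ * u ζ

/-- Gibbs weight `μ_β(σ)`. -/
noncomputable def gibbsWeight (L q : ℕ) (β : ℝ) (σ : Conf L q) : ℝ :=
  Real.exp (-β * (Ham L q σ : ℝ)) / Zfun L q β

/-- The Dirichlet form `D_β(f)`. -/
noncomputable def dirichletForm (L q : ℕ) (β : ℝ) (f : Conf L q → ℝ) : ℝ :=
  (1 / 2) * ∑' p : Conf L q × Conf L q,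
    gibbsWeight L q β p.1 * rate L q β p.1 p.2 * (f p.2 - f p.1) ^ 2

/-- `h` is the equilibrium potential `h^β_{A,B}(σ) = P_σ[τ_A < τ_B]`: it equals `1` on
`A`, `0` on `B`, and is harmonic for the Metropolis dynamics off `A ∪ B`. -/
def IsEqPotential (L q : ℕ) (β : ℝ) (A B : Set (Conf L q)) (h : Conf L q → ℝ) : Prop :=
  (∀ σ ∈ A, h σ = 1) ∧ (∀ σ ∈ B, h σ = 0) ∧
    ∀ σ, σ ∉ A → σ ∉ B → (∑' ζ : Conf L q, rate L q β σ ζ * (h σ - h ζ)) = 0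


/-- `1` if the two arguments differ, `0` otherwise. -/
noncomputable def dd {α : Type*} (x y : α) : ℕ := if x = y then 0 else 1

theorem dd_self {α : Type*} (x : α) : dd x x = 0 := by simp [dd]

theorem dd_of_ne {α : Type*} {x y : α} (h : x ≠ y) : dd x y = 1 := by simp [dd, h]

theorem dd_le_one {α : Type*} (x y : α) : dd x y ≤ 1 := by unfold dd; split <;> omega

theorem dd_eq_zero {α : Type*} {x y : α} : dd x y = 0 ↔ x = y := by
  unfold dd; split <;> simp_all

theorem dd_comm {α : Type*} (x y : α) : dd x y = dd y x := by simp [dd, eq_comm]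

section Basic

variable {L q : ℕ}

/-- The number of changes on edges of type `0`. -/
noncomputable def E0 [NeZero L] (τ : Conf L q) : ℕ :=
  ∑ p : ZMod L × ZMod L, dd (τ (p, false)) (τ (p, true))

/-- The number of changes on edges of type `1`. -/
noncomputable def E1 [NeZero L] (τ : Conf L q) : ℕ :=
  ∑ p : ZMod L × ZMod L, dd (τ (p, false)) (τ ((p.1 - 1, p.2), true))

/-- The number of changes on edges of type `2`. -/
noncomputable def E2 [NeZero L] (τ : Conf L q) : ℕ :=
  ∑ p : ZMod L × ZMod L, dd (τ (p, false)) (τ ((p.1, p.2 - 1), true))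

/-- The base point of the down-triangle adjacent to an up-triangle. -/
def nb (p : ZMod L × ZMod L) (t : Fin 3) : ZMod L × ZMod L :=
  if t = 0 then p else if t = 1 then (p.1 - 1, p.2) else (p.1, p.2 - 1)

theorem one_ne_zero_of_two_le (h : 2 ≤ L) : (1 : ZMod L) ≠ 0 := by
  have : Fact (1 < L) := ⟨by omega⟩
  exact one_ne_zero

theorem nb_inj (h : 2 ≤ L) (p : ZMod L × ZMod L) {s t : Fin 3} (hst : nb p s = nb p t) :
    s = t := by
  have h1 := one_ne_zero_of_two_le h
  obtain ⟨x, y⟩ := p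
  fin_cases s <;> fin_cases t <;> simp [nb, Prod.ext_iff] at hst ⊢ <;>
    first
    | exact absurd hst h1
    | exact h1 (by linear_combination hst)
    | exact h1 (by linear_combination -hst)
    | exact h1 (by linear_combination hst.1)
    | exact h1 (by linear_combination hst.2)

theorem hexAdj_up_iff (p r : ZMod L × ZMod L) :
    hexAdj ((p, false) : Site L) (r, true) ↔ ∃ t : Fin 3, r = nb p t := by
  constructor
  · rintro (⟨_, _, h⟩ | ⟨h, _⟩)
    · rcases h with h | h | h
      · exact ⟨0, by simpa [nb] using h⟩
      · exact ⟨1, by simpa [nb] using h⟩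
      · exact ⟨2, by simpa [nb] using h⟩
    · simp at h
  · rintro ⟨t, rfl⟩
    left
    refine ⟨rfl, rfl, ?_⟩
    fin_cases t <;> simp [nb]

theorem Ham_eq [NeZero L] (h : 2 ≤ L) (τ : Conf L q) : Ham L q τ = E0 τ + E1 τ + E2 τ := by
  have e : {x : (ZMod L × ZMod L) × Fin 3 // τ (x.1, false) ≠ τ (nb x.1 x.2, true)} ≃
      {e : Site L × Site L // e.1.2 = false ∧ hexAdj e.1 e.2 ∧ τ e.1 ≠ τ e.2} := by
    refine Equiv.ofBijective
      (fun x => ⟨((x.1.1, false), (nb x.1.1 x.1.2, true)), rfl,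
        (hexAdj_up_iff _ _).2 ⟨_, rfl⟩, x.2⟩) ⟨?_, ?_⟩
    · rintro ⟨⟨p, s⟩, hx⟩ ⟨⟨r, t⟩, hy⟩ hxy
      simp only [Subtype.mk.injEq, Prod.mk.injEq, and_true] at hxy
      obtain ⟨rfl, h2⟩ := hxy
      have := nb_inj h p h2
      subst this
      rfl
    · rintro ⟨⟨⟨p, b⟩, ⟨r, c⟩⟩, hb, hadj, hne⟩
      simp only at hb
      subst hb
      have hc : c = true := by
        rcases hadj with ⟨_, h, _⟩ | ⟨h, _⟩
        · exact h
        · simp at h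
      subst hc
      obtain ⟨t, rfl⟩ := (hexAdj_up_iff _ _).1 hadj
      exact ⟨⟨(p, t), hne⟩, rfl⟩
  unfold Ham
  rw [← Nat.card_congr e, Nat.card_eq_fintype_card, Fintype.card_subtype, Finset.card_filter,
    Fintype.sum_prod_type]
  simp only [Fin.sum_univ_three]
  rw [Finset.sum_add_distrib, Finset.sum_add_distrib]
  have hdd : ∀ x y : Fin q, (if x ≠ y then 1 else 0) = dd x y := by
    intro x y
    by_cases h : x = y <;> simp [dd, h]
  simp only [hdd]
  simp [E0, E1, E2, nb]

/-- Reflection swapping rows and columns. -/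
def sw : Site L ≃ Site L where
  toFun v := ((v.1.2, v.1.1), v.2)
  invFun v := ((v.1.2, v.1.1), v.2)
  left_inv _ := rfl
  right_inv _ := rfl

/-- Reflection swapping rows and diagonals. -/
def tw : Site L ≃ Site L where
  toFun v := ((v.1.1, -v.1.1 - v.1.2 - (if v.2 then 1 else 0)), v.2)
  invFun v := ((v.1.1, -v.1.1 - v.1.2 - (if v.2 then 1 else 0)), v.2)
  left_inv v := by
    obtain ⟨⟨x, y⟩, b⟩ := v
    simp only [Prod.mk.injEq, and_true, true_and]
    ring
  right_inv v := by
    obtain ⟨⟨x, y⟩, b⟩ := v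
    simp only [Prod.mk.injEq, and_true, true_and]
    ring

@[simp] theorem sw_apply (x y : ZMod L) (b : Bool) :
    sw (((x, y), b) : Site L) = ((y, x), b) := rfl

@[simp] theorem tw_up (x y : ZMod L) :
    tw (((x, y), false) : Site L) = ((x, -x - y), false) := by simp [tw]

@[simp] theorem tw_down (x y : ZMod L) :
    tw (((x, y), true) : Site L) = ((x, -x - y - 1), true) := by simp [tw]

theorem sum_swap [NeZero L] (f : ZMod L × ZMod L → ℕ) :
    ∑ p : ZMod L × ZMod L, f (p.2, p.1) = ∑ p, f p :=
  (Equiv.prodComm (ZMod L) (ZMod L)).sum_comp f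

/-- The reflection `(x, y) ↦ (x, -x-y)` of the torus. -/
def refl2 : ZMod L × ZMod L ≃ ZMod L × ZMod L where
  toFun p := (p.1, -p.1 - p.2)
  invFun p := (p.1, -p.1 - p.2)
  left_inv p := by simp
  right_inv p := by simp

theorem E_sw [NeZero L] (τ : Conf L q) :
    E0 (τ ∘ sw) = E0 τ ∧ E1 (τ ∘ sw) = E2 τ ∧ E2 (τ ∘ sw) = E1 τ := by
  refine ⟨?_, ?_, ?_⟩
  · exact sum_swap (fun p => dd (τ (p, false)) (τ (p, true)))
  · exact sum_swap (fun p => dd (τ (p, false)) (τ ((p.1, p.2 - 1), true)))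
  · exact sum_swap (fun p => dd (τ (p, false)) (τ ((p.1 - 1, p.2), true)))

theorem E_tw [NeZero L] (τ : Conf L q) :
    E0 (τ ∘ tw) = E2 τ ∧ E1 (τ ∘ tw) = E1 τ ∧ E2 (τ ∘ tw) = E0 τ := by
  refine ⟨?_, ?_, ?_⟩
  · refine Fintype.sum_equiv refl2 _ _ ?_
    rintro ⟨x, y⟩
    simp only [Function.comp, tw_up, tw_down, refl2, Equiv.coe_fn_mk]
  · refine Fintype.sum_equiv refl2 _ _ ?_
    rintro ⟨x, y⟩
    have : -(x - 1) - y - 1 = -x - y := by ring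
    simp only [Function.comp, tw_up, tw_down, refl2, Equiv.coe_fn_mk, this]
  · refine Fintype.sum_equiv refl2 _ _ ?_
    rintro ⟨x, y⟩
    have : -x - (y - 1) - 1 = -x - y := by ring
    simp only [Function.comp, tw_up, tw_down, refl2, Equiv.coe_fn_mk, this]

theorem Ham_sw [NeZero L] (h : 2 ≤ L) (τ : Conf L q) : Ham L q (τ ∘ sw) = Ham L q τ := by
  rw [Ham_eq h, Ham_eq h]
  obtain ⟨h0, h1, h2⟩ := E_sw τ
  omega

theorem Ham_tw [NeZero L] (h : 2 ≤ L) (τ : Conf L q) : Ham L q (τ ∘ tw) = Ham L q τ := by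
  rw [Ham_eq h, Ham_eq h]
  obtain ⟨h0, h1, h2⟩ := E_tw τ
  omega

/-- Energy of a row. -/
noncomputable def rowE [NeZero L] (τ : Conf L q) (j : ZMod L) : ℕ :=
  ∑ i : ZMod L, (dd (τ ((i, j), false)) (τ ((i, j), true)) +
    dd (τ ((i, j), false)) (τ ((i - 1, j), true)))

/-- Total energy of the rows. -/
noncomputable def totE [NeZero L] (τ : Conf L q) : ℕ := ∑ j : ZMod L, rowE τ j

theorem totE_eq [NeZero L] (τ : Conf L q) : totE τ = E0 τ + E1 τ := by
  unfold totE rowE E0 E1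
  rw [Finset.sum_comm, ← Finset.sum_add_distrib, Fintype.sum_prod_type]

theorem two_Ham [NeZero L] (h : 2 ≤ L) (τ : Conf L q) :
    2 * Ham L q τ = totE τ + totE (τ ∘ sw) + totE (τ ∘ tw) := by
  rw [Ham_eq h, totE_eq, totE_eq, totE_eq]
  obtain ⟨h0, h1, h2⟩ := E_tw τ
  obtain ⟨h0, h1, h2⟩ := E_sw τ
  omega

/-- The row `j` is constantly `a`. -/
def RowC (τ : Conf L q) (j : ZMod L) (a : Fin q) : Prop :=
  ∀ (i : ZMod L) (b : Bool), τ ((i, j), b) = a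

/-- The row `j` is constant. -/
def RowK (τ : Conf L q) (j : ZMod L) : Prop := ∃ a, RowC τ j a

end Basic

section Planar

theorem line_right (U D : ℤ → Prop) (N : ℤ) (hN : ∀ x, U x ∨ D x → x ≤ N)
    (hne : ∃ x, U x ∨ D x) : ∃ x, (U x ∧ ¬ D x) ∨ (D x ∧ ¬ U (x + 1)) := by
  by_contra! hcon
  obtain ⟨x, hx⟩ := hne
  have key : ∀ n : ℕ, D (x + n) := by
    intro n
    induction n with
    | zero =>
      rcases hx with hx | hx
      · simpa using (hcon x).1 hx
      · simpa using hx
    | succ n ih =>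
      have h1 := (hcon _).1 ((hcon _).2 ih)
      push_cast
      rwa [← add_assoc]
  have h1 := hN _ (Or.inr (key (N - x + 1).toNat))
  have h2 := hN x hx
  have h3 : (((N - x + 1).toNat : ℕ) : ℤ) = N - x + 1 := Int.toNat_of_nonneg (by omega)
  omega

theorem line_left (U D : ℤ → Prop) (N : ℤ) (hN : ∀ x, U x ∨ D x → -N ≤ x)
    (hne : ∃ x, U x ∨ D x) : ∃ x, (¬ U x ∧ D x) ∨ (¬ D x ∧ U (x + 1)) := by
  by_contra! hcon
  obtain ⟨x, hx⟩ := hne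
  have hDU : ∀ y, D y → U y := fun y hy => by
    by_contra h
    exact (hcon y).1 h hy
  have hUD : ∀ y, U (y + 1) → D y := fun y hy => by
    by_contra h
    exact (hcon y).2 h hy
  have key : ∀ n : ℕ, U (x - n) := by
    intro n
    induction n with
    | zero =>
      rcases hx with hx | hx
      · simpa using hx
      · simpa using hDU _ hx
    | succ n ih =>
      apply hDU
      apply hUD
      push_cast
      have : x - ((n : ℤ) + 1) + 1 = x - n := by ring
      rwa [this]
  have h1 := hN _ (Or.inl (key (x + N + 1).toNat))
  have h2 := hN x hx
  have h3 : (((x + N + 1).toNat : ℕ) : ℤ) = x + N + 1 := Int.toNat_of_nonneg (by omega)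
  omega

theorem lines_bound (U D : ℤ → ℤ → Prop) (Y : Finset ℤ) (N : ℤ)
    (hN : ∀ y x, U y x ∨ D y x → -N ≤ x ∧ x ≤ N)
    (hY : ∀ y ∈ Y, ∃ x, U y x ∨ D y x) (G0 G1 : Finset (ℤ × ℤ))
    (h0 : ∀ y x, ¬ (U y x ↔ D y x) → (y, x) ∈ G0)
    (h1 : ∀ y x, ¬ (D y x ↔ U y (x + 1)) → (y, x) ∈ G1) :
    2 * Y.card ≤ G0.card + G1.card := by
  have hR : Y ⊆ (G0.filter (fun p => U p.1 p.2)).image Prod.fst ∪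
      (G1.filter (fun p => D p.1 p.2)).image Prod.fst := by
    intro y hy
    obtain ⟨x, hx⟩ := line_right (U y) (D y) N (fun x hx => (hN y x hx).2) (hY y hy)
    rw [Finset.mem_union, Finset.mem_image, Finset.mem_image]
    rcases hx with hx | hx
    · left
      exact ⟨(y, x), Finset.mem_filter.2 ⟨h0 y x (by tauto), hx.1⟩, rfl⟩
    · right
      exact ⟨(y, x), Finset.mem_filter.2 ⟨h1 y x (by tauto), hx.1⟩, rfl⟩
  have hL : Y ⊆ (G0.filter (fun p => ¬ U p.1 p.2)).image Prod.fst ∪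
      (G1.filter (fun p => ¬ D p.1 p.2)).image Prod.fst := by
    intro y hy
    obtain ⟨x, hx⟩ := line_left (U y) (D y) N (fun x hx => (hN y x hx).1) (hY y hy)
    rw [Finset.mem_union, Finset.mem_image, Finset.mem_image]
    rcases hx with hx | hx
    · left
      exact ⟨(y, x), Finset.mem_filter.2 ⟨h0 y x (by tauto), hx.1⟩, rfl⟩
    · right
      exact ⟨(y, x), Finset.mem_filter.2 ⟨h1 y x (by tauto), hx.1⟩, rfl⟩
  have a1 := (Finset.card_le_card hR).trans (Finset.card_union_le _ _)
  have a2 := (Finset.card_le_card hL).trans (Finset.card_union_le _ _)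
  have b1 := Finset.card_image_le (s := G0.filter (fun p => U p.1 p.2)) (f := Prod.fst)
  have b2 := Finset.card_image_le (s := G1.filter (fun p => D p.1 p.2)) (f := Prod.fst)
  have b3 := Finset.card_image_le (s := G0.filter (fun p => ¬ U p.1 p.2)) (f := Prod.fst)
  have b4 := Finset.card_image_le (s := G1.filter (fun p => ¬ D p.1 p.2)) (f := Prod.fst)
  have c1 := Finset.card_filter_add_card_filter_not (s := G0) (fun p => U p.1 p.2)
  have c2 := Finset.card_filter_add_card_filter_not (s := G1) (fun p => D p.1 p.2)
  omega

/-- Pollard-type bound for the number of pairs with sum outside `Z`. -/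
theorem pollard (Z : Finset ℤ) (u : ℕ) : ∀ X Y : Finset ℤ, u ≤ X.card → u ≤ Y.card →
    u * (X.card + Y.card) ≤
      ((X ×ˢ Y).filter (fun p => p.1 + p.2 ∉ Z)).card + u * Z.card + u ^ 2 := by
  induction u with
  | zero => intros; simp
  | succ u ih =>
    intro X Y hX hY
    have hXn : X.Nonempty := Finset.card_pos.1 (by omega)
    have hYn : Y.Nonempty := Finset.card_pos.1 (by omega)
    set m := X.min' hXn with hm
    set M := Y.max' hYn with hM
    have hmX : m ∈ X := X.min'_mem hXn
    have hMY : M ∈ Y := Y.max'_mem hYn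
    have hX' : (X.erase m).card + 1 = X.card := Finset.card_erase_add_one hmX
    have hY' : (Y.erase M).card + 1 = Y.card := Finset.card_erase_add_one hMY
    have IH := ih (X.erase m) (Y.erase M) (by omega) (by omega)
    set S1 := (Y.image (fun j => m + j)) with hS1
    set S2 := ((X.erase m).image (fun i => i + M)) with hS2
    have c1 : S1.card = Y.card := Finset.card_image_of_injective _ (fun a b h => by simpa using h)
    have c2 : S2.card = (X.erase m).card :=
      Finset.card_image_of_injective _ (fun a b h => by simpa using h)
    have hdis : Disjoint S1 S2 := by
      rw [Finset.disjoint_left]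
      intro s h1 h2
      obtain ⟨j, hj, rfl⟩ := Finset.mem_image.1 h1
      obtain ⟨i, hi, h⟩ := Finset.mem_image.1 h2
      have h3 : j ≤ M := Y.le_max' j hj
      have h4 : m ≤ i := X.min'_le i (Finset.mem_of_mem_erase hi)
      have h5 := Finset.ne_of_mem_erase hi
      omega
    have hS : (S1 ∪ S2).card = Y.card + (X.erase m).card := by
      rw [Finset.card_union_of_disjoint hdis, c1, c2]
    have hSZ : (S1 ∪ S2).card ≤ ((S1 ∪ S2) \ Z).card + Z.card := by
      have := Finset.le_card_sdiff Z (S1 ∪ S2)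
      omega
    set hook := ((X ×ˢ Y).filter (fun p => p.1 + p.2 ∉ Z)) \
      (((X.erase m) ×ˢ (Y.erase M)).filter (fun p => p.1 + p.2 ∉ Z)) with hhook
    have hsub : ((S1 ∪ S2) \ Z) ⊆ hook.image (fun p => p.1 + p.2) := by
      intro s hs
      rw [Finset.mem_sdiff, Finset.mem_union] at hs
      obtain ⟨hs, hsZ⟩ := hs
      rw [Finset.mem_image]
      rcases hs with hs | hs
      · obtain ⟨j, hj, rfl⟩ := Finset.mem_image.1 hs
        refine ⟨(m, j), ?_, rfl⟩
        simp only [hhook, Finset.mem_sdiff, Finset.mem_filter, Finset.mem_product]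
        refine ⟨⟨⟨hmX, hj⟩, hsZ⟩, ?_⟩
        simp
      · obtain ⟨i, hi, rfl⟩ := Finset.mem_image.1 hs
        refine ⟨(i, M), ?_, rfl⟩
        simp only [hhook, Finset.mem_sdiff, Finset.mem_filter, Finset.mem_product]
        refine ⟨⟨⟨Finset.mem_of_mem_erase hi, hMY⟩, hsZ⟩, ?_⟩
        simp
    have h1 := (Finset.card_le_card hsub).trans Finset.card_image_le
    have h2 : hook.card + (((X.erase m) ×ˢ (Y.erase M)).filter (fun p => p.1 + p.2 ∉ Z)).card =
        ((X ×ˢ Y).filter (fun p => p.1 + p.2 ∉ Z)).card := by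
      rw [hhook]
      apply Finset.card_sdiff_add_card_eq_card
      apply Finset.filter_subset_filter
      exact Finset.product_subset_product (Finset.erase_subset _ _) (Finset.erase_subset _ _)
    have h3 : X.card = (X.erase m).card + 1 := hX'.symm
    have h4 : Y.card = (Y.erase M).card + 1 := hY'.symm
    rw [← h2]
    rw [h3, h4]
    rw [h4] at hS
    nlinarith

theorem pollard_Z (X Y Z : Finset ℤ) (u : ℕ) (hX : u ≤ X.card) (hY : u ≤ Y.card) :
    ((((X ×ˢ Y).filter (fun p => p.1 + p.2 ∈ Z)).card : ℕ) : ℤ) ≤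
      X.card * Y.card - u * (X.card + Y.card - Z.card) + u ^ 2 := by
  have h := pollard Z u X Y hX hY
  have h2 := Finset.card_filter_add_card_filter_not (s := X ×ˢ Y) (fun p => p.1 + p.2 ∈ Z)
  rw [Finset.card_product] at h2
  zify at h h2
  nlinarith

/-- arithmetic conclusion of the isoperimetric inequality -/
theorem iso_arith (x y z N : ℕ) (hN : ∀ u : ℕ, u ≤ x → u ≤ y →
    (N : ℤ) ≤ 2 * (x * y - u * (x + y - z) + u ^ 2)) : 6 * N ≤ (x + y + z) ^ 2 + 3 := by
  zify
  by_cases h1 : x + y ≤ z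
  · have := hN 0 (by omega) (by omega)
    zify at h1
    push_cast at this
    nlinarith [sq_nonneg ((x : ℤ) - y)]
  · by_cases h2 : x + y ≤ z + 2 * min x y
    · obtain ⟨u, hu⟩ : ∃ u, u = (x + y - z) / 2 := ⟨_, rfl⟩
      have hux : u ≤ x := by omega
      have huy : u ≤ y := by omega
      have := hN u hux huy
      have hw : (x + y : ℤ) - z = 2 * u ∨ (x + y : ℤ) - z = 2 * u + 1 := by omega
      rcases hw with hw | hw
      · rw [hw] at this
        have hz : (z : ℤ) = x + y - 2 * u := by linarith
        rw [hz]
        nlinarith [sq_nonneg ((x : ℤ) - y), sq_nonneg ((x : ℤ) + y - 4 * u)]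
      · rw [hw] at this
        have hz : (z : ℤ) = x + y - 2 * u - 1 := by linarith
        rw [hz]
        nlinarith [sq_nonneg ((x : ℤ) - y), sq_nonneg ((x : ℤ) + y - 4 * u - 2)]
    · rcases le_total x y with hxy | hxy
      · have := hN x le_rfl hxy
        have h3 : (x : ℤ) + z ≤ y := by omega
        nlinarith [sq_nonneg ((x : ℤ) - z)]
      · have := hN y hxy le_rfl
        have h3 : (y : ℤ) + z ≤ x := by omega
        nlinarith [sq_nonneg ((y : ℤ) - z)]

/-- The isoperimetric inequality for finite sets of triangles in the plane. -/
theorem planar_iso (V : Finset ((ℤ × ℤ) × Bool)) (F0 F1 F2 : Finset (ℤ × ℤ))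
    (h0 : ∀ x y, ¬ (((x, y), false) ∈ V ↔ ((x, y), true) ∈ V) → (x, y) ∈ F0)
    (h1 : ∀ x y, ¬ (((x, y), false) ∈ V ↔ ((x - 1, y), true) ∈ V) → (x, y) ∈ F1)
    (h2 : ∀ x y, ¬ (((x, y), false) ∈ V ↔ ((x, y - 1), true) ∈ V) → (x, y) ∈ F2) :
    6 * V.card ≤ (F0.card + F1.card + F2.card) ^ 2 + 3 := by
  obtain ⟨N, hN⟩ : ∃ N : ℤ, ∀ v ∈ V, (-N ≤ v.1.1 ∧ v.1.1 ≤ N) ∧ (-N ≤ v.1.2 ∧ v.1.2 ≤ N) := by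
    refine ⟨∑ v ∈ V, (|v.1.1| + |v.1.2|), fun v hv => ?_⟩
    have := Finset.single_le_sum (f := fun v : (ℤ × ℤ) × Bool => |v.1.1| + |v.1.2|)
      (fun v _ => by positivity) hv
    have a1 := neg_abs_le v.1.1
    have a2 := le_abs_self v.1.1
    have a3 := neg_abs_le v.1.2
    have a4 := le_abs_self v.1.2
    have a5 := abs_nonneg v.1.1
    have a6 := abs_nonneg v.1.2
    refine ⟨⟨?_, ?_⟩, ?_, ?_⟩ <;> linarith
  set X := V.image (fun v => v.1.1) with hX
  set Y := V.image (fun v => v.1.2) with hY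
  set Z := V.image (fun v => v.1.1 + v.1.2 + (if v.2 then 1 else 0)) with hZ
  have rY : 2 * Y.card ≤ F0.card + F1.card := by
    have := lines_bound (fun y x => ((x, y), false) ∈ V) (fun y x => ((x, y), true) ∈ V) Y N
      (by rintro y x (h | h) <;> exact (hN _ h).1)
      (by
        intro y hy
        obtain ⟨⟨⟨x, y⟩, b⟩, hv, rfl⟩ := Finset.mem_image.1 hy
        refine ⟨x, ?_⟩
        cases b
        · exact Or.inl hv
        · exact Or.inr hv)
      (F0.image (fun p => (p.2, p.1))) (F1.image (fun p => (p.2, p.1 - 1)))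
      (by
        intro y x h
        exact Finset.mem_image.2 ⟨(x, y), h0 x y h, rfl⟩)
      (by
        intro y x h
        refine Finset.mem_image.2 ⟨(x + 1, y), h1 (x + 1) y ?_, by simp⟩
        rw [add_sub_cancel_right]
        tauto)
    exact this.trans (add_le_add Finset.card_image_le Finset.card_image_le)
  have rX : 2 * X.card ≤ F0.card + F2.card := by
    have := lines_bound (fun x y => ((x, y), false) ∈ V) (fun x y => ((x, y), true) ∈ V) X N
      (by rintro y x (h | h) <;> exact (hN _ h).2)
      (by
        intro y hy
        obtain ⟨⟨⟨x, y⟩, b⟩, hv, rfl⟩ := Finset.mem_image.1 hy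
        refine ⟨y, ?_⟩
        cases b
        · exact Or.inl hv
        · exact Or.inr hv)
      F0 (F2.image (fun p => (p.1, p.2 - 1)))
      (by
        intro x y h
        exact h0 x y h)
      (by
        intro x y h
        refine Finset.mem_image.2 ⟨(x, y + 1), h2 x (y + 1) ?_, by simp⟩
        rw [add_sub_cancel_right]
        tauto)
    exact this.trans (add_le_add le_rfl Finset.card_image_le)
  have rZ : 2 * Z.card ≤ F2.card + F1.card := by
    have := lines_bound (fun z x => ((x, z - x), false) ∈ V)
      (fun z x => ((x, z - x - 1), true) ∈ V) Z N
      (by rintro y x (h | h) <;> exact (hN _ h).1)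
      (by
        intro z hz
        obtain ⟨⟨⟨x, y⟩, b⟩, hv, rfl⟩ := Finset.mem_image.1 hz
        refine ⟨x, ?_⟩
        cases b
        · left
          simpa using hv
        · right
          have : x + y + 1 - x - 1 = y := by ring
          simpa [this] using hv)
      (F2.image (fun p => (p.1 + p.2, p.1))) (F1.image (fun p => (p.1 + p.2, p.1 - 1)))
      (by
        intro z x h
        exact Finset.mem_image.2 ⟨(x, z - x), h2 x (z - x) h, by simp⟩)
      (by
        intro z x h
        refine Finset.mem_image.2 ⟨(x + 1, z - x - 1), h1 (x + 1) (z - x - 1) ?_, by simp⟩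
        rw [add_sub_cancel_right]
        have : z - (x + 1) = z - x - 1 := by ring
        rw [this] at h
        tauto)
    exact this.trans (add_le_add Finset.card_image_le Finset.card_image_le)
  have hcard : ∀ u : ℕ, u ≤ X.card → u ≤ Y.card → (V.card : ℤ) ≤
      2 * (X.card * Y.card - u * (X.card + Y.card - Z.card) + u ^ 2) := by
    intro u hux huy
    have p1 := pollard_Z X Y Z u hux huy
    have p2 := pollard_Z X Y (Z.image (fun z => z - 1)) u hux huy
    have hZc : (Z.image (fun z => z - 1)).card = Z.card :=
      Finset.card_image_of_injective _ (fun a b h => by simpa using h)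
    rw [hZc] at p2
    have hsub : V ⊆ ((X ×ˢ Y).filter (fun p => p.1 + p.2 ∈ Z)).image (fun p => (p, false)) ∪
        ((X ×ˢ Y).filter (fun p => p.1 + p.2 ∈ Z.image (fun z => z - 1))).image
          (fun p => (p, true)) := by
      rintro ⟨⟨x, y⟩, b⟩ hv
      have hx : x ∈ X := Finset.mem_image.2 ⟨_, hv, rfl⟩
      have hy : y ∈ Y := Finset.mem_image.2 ⟨_, hv, rfl⟩
      have hz : x + y + (if b then 1 else 0) ∈ Z := Finset.mem_image.2 ⟨_, hv, rfl⟩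
      rw [Finset.mem_union]
      cases b
      · left
        refine Finset.mem_image.2 ⟨(x, y), Finset.mem_filter.2 ⟨?_, ?_⟩, rfl⟩
        · exact Finset.mem_product.2 ⟨hx, hy⟩
        · simpa using hz
      · right
        refine Finset.mem_image.2 ⟨(x, y), Finset.mem_filter.2 ⟨?_, ?_⟩, rfl⟩
        · exact Finset.mem_product.2 ⟨hx, hy⟩
        · refine Finset.mem_image.2 ⟨_, hz, ?_⟩
          simp
    have := (Finset.card_le_card hsub).trans
      ((Finset.card_union_le _ _).trans (add_le_add Finset.card_image_le Finset.card_image_le))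
    zify at this
    linarith
  have := iso_arith X.card Y.card Z.card V.card hcard
  have hp : X.card + Y.card + Z.card ≤ F0.card + F1.card + F2.card := by omega
  have := Nat.pow_le_pow_left hp 2
  omega

end Planar

section Cross

variable {L q : ℕ}

theorem sum_dd {ι α : Type*} [Fintype ι] (f g : ι → α) :
    ∑ p, dd (f p) (g p) = (Finset.univ.filter (fun p => f p ≠ g p)).card := by
  rw [Finset.card_filter]
  refine Finset.sum_congr rfl fun p _ => ?_
  by_cases h : f p = g p <;> simp [dd, h]

theorem cast_window [NeZero L] (i0 j0 : ZMod L) :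
    Set.InjOn (fun p : ℤ × ℤ => (i0 + (p.1 : ZMod L), j0 + (p.2 : ZMod L)))
      {p | 1 ≤ p.1 ∧ p.1 ≤ L ∧ 1 ≤ p.2 ∧ p.2 ≤ L} := by
  have key : ∀ x y : ℤ, 1 ≤ x → x ≤ L → 1 ≤ y → y ≤ L → (x : ZMod L) = y → x = y := by
    intro x y h1 h2 h3 h4 h
    rw [ZMod.intCast_eq_intCast_iff_dvd_sub] at h
    obtain ⟨k, hk⟩ := h
    have hL : (0 : ℤ) < L := by exact_mod_cast Nat.pos_of_ne_zero (NeZero.ne L)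
    have hk1 : k < 1 := by nlinarith
    have hk2 : -1 < k := by nlinarith
    have : k = 0 := by omega
    subst this
    simp at hk
    omega
  rintro ⟨x, y⟩ ⟨h1, h2, h3, h4⟩ ⟨x', y'⟩ ⟨h1', h2', h3', h4'⟩ h
  simp only [Prod.mk.injEq, add_right_inj] at h
  rw [key x x' h1 h2 h1' h2' h.1, key y y' h3 h4 h3' h4' h.2]

set_option maxHeartbeats 1000000 in
theorem cross_bound [NeZero L] (hL : 2 ≤ L) (τ : Conf L q) (i0 j0 : ZMod L)
    (W : Finset (Fin q)) (hrow : ∀ i b, τ ((i, j0), b) ∉ W) (hcol : ∀ j b, τ ((i0, j), b) ∉ W) :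
    6 * (Finset.univ.filter (fun v : Site L => τ v ∈ W)).card ≤ Ham L q τ ^ 2 + 3 := by
  set pr : (ℤ × ℤ) → ZMod L × ZMod L := fun p => (i0 + (p.1 : ZMod L), j0 + (p.2 : ZMod L))
    with hpr
  set V : Finset ((ℤ × ℤ) × Bool) :=
    ((Finset.Icc (1 : ℤ) (L - 1) ×ˢ Finset.Icc (1 : ℤ) (L - 1)) ×ˢ Finset.univ).filter
      (fun v => τ (pr v.1, v.2) ∈ W) with hV
  have memV : ∀ (x y : ℤ) (b : Bool), ((x, y), b) ∈ V ↔
      ((1 ≤ x ∧ x ≤ (L : ℤ) - 1) ∧ (1 ≤ y ∧ y ≤ (L : ℤ) - 1)) ∧ τ (pr (x, y), b) ∈ W := by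
    intro x y b
    simp [hV]
  have memV' : ∀ (x y : ℤ) (b : Bool), 0 ≤ x → x ≤ (L : ℤ) → 0 ≤ y → y ≤ (L : ℤ) →
      (((x, y), b) ∈ V ↔ τ (pr (x, y), b) ∈ W) := by
    intro x y b hx hx' hy hy'
    rw [memV]
    refine ⟨fun h => h.2, fun h => ⟨⟨?_, ?_⟩, h⟩⟩
    · by_contra hc
      have : (x : ZMod L) = 0 := by
        have : x = 0 ∨ x = L := by omega
        rcases this with rfl | rfl <;> simp
      apply hcol (j0 + (y : ZMod L)) b
      simpa [hpr, this] using h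
    · by_contra hc
      have : (y : ZMod L) = 0 := by
        have : y = 0 ∨ y = L := by omega
        rcases this with rfl | rfl <;> simp
      apply hrow (i0 + (x : ZMod L)) b
      simpa [hpr, this] using h
  set I : Finset (ℤ × ℤ) := Finset.Icc (1 : ℤ) L ×ˢ Finset.Icc (1 : ℤ) L with hI
  set F0 := I.filter (fun p => τ (pr p, false) ≠ τ (pr p, true)) with hF0
  set F1 := I.filter (fun p => τ (pr p, false) ≠ τ (((pr p).1 - 1, (pr p).2), true)) with hF1
  set F2 := I.filter (fun p => τ (pr p, false) ≠ τ (((pr p).1, (pr p).2 - 1), true)) with hF2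
  have hinj : Set.InjOn pr (I : Set (ℤ × ℤ)) := by
    refine (cast_window i0 j0).mono ?_
    intro p hp
    rw [Finset.mem_coe, hI, Finset.mem_product, Finset.mem_Icc, Finset.mem_Icc] at hp
    exact ⟨hp.1.1, hp.1.2, hp.2.1, hp.2.2⟩
  have c0 : F0.card ≤ E0 τ := by
    unfold E0
    rw [sum_dd]
    refine Finset.card_le_card_of_injOn pr ?_ (hinj.mono ?_)
    · intro p hp
      simpa using (Finset.mem_filter.1 hp).2
    · intro p hp
      exact (Finset.mem_filter.1 hp).1
  have c1 : F1.card ≤ E1 τ := by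
    unfold E1
    rw [sum_dd]
    refine Finset.card_le_card_of_injOn pr ?_ (hinj.mono ?_)
    · intro p hp
      simpa using (Finset.mem_filter.1 hp).2
    · intro p hp
      exact (Finset.mem_filter.1 hp).1
  have c2 : F2.card ≤ E2 τ := by
    unfold E2
    rw [sum_dd]
    refine Finset.card_le_card_of_injOn pr ?_ (hinj.mono ?_)
    · intro p hp
      simpa using (Finset.mem_filter.1 hp).2
    · intro p hp
      exact (Finset.mem_filter.1 hp).1
  have iso := planar_iso V F0 F1 F2
    (by
      intro x y h
      have hw : (1 ≤ x ∧ x ≤ L - 1) ∧ (1 ≤ y ∧ y ≤ L - 1) := by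
        by_contra hc
        apply h
        rw [memV, memV]
        constructor
        · rintro ⟨h1, h2⟩
          exact absurd (by omega) hc
        · rintro ⟨h1, h2⟩
          exact absurd (by omega) hc
      rw [memV' _ _ _ (by omega) (by omega) (by omega) (by omega),
        memV' _ _ _ (by omega) (by omega) (by omega) (by omega)] at h
      refine Finset.mem_filter.2 ⟨?_, fun he => h (by rw [he])⟩
      simp only [hI, Finset.mem_product, Finset.mem_Icc]
      omega)
    (by
      intro x y h
      have hw : (1 ≤ x ∧ x ≤ L) ∧ (1 ≤ y ∧ y ≤ L - 1) := by
        by_contra hc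
        apply h
        rw [memV, memV]
        constructor
        · rintro ⟨h1, h2⟩
          exact absurd (by omega) hc
        · rintro ⟨h1, h2⟩
          exact absurd (by omega) hc
      rw [memV' _ _ _ (by omega) (by omega) (by omega) (by omega),
        memV' _ _ _ (by omega) (by omega) (by omega) (by omega)] at h
      refine Finset.mem_filter.2 ⟨?_, fun he => h ?_⟩
      · simp only [hI, Finset.mem_product, Finset.mem_Icc]
        omega
      · have : pr (x - 1, y) = ((pr (x, y)).1 - 1, (pr (x, y)).2) := by
          simp only [hpr]
          push_cast
          ring_nf
        rw [he, this])
    (by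
      intro x y h
      have hw : (1 ≤ x ∧ x ≤ L - 1) ∧ (1 ≤ y ∧ y ≤ L) := by
        by_contra hc
        apply h
        rw [memV, memV]
        constructor
        · rintro ⟨h1, h2⟩
          exact absurd (by omega) hc
        · rintro ⟨h1, h2⟩
          exact absurd (by omega) hc
      rw [memV' _ _ _ (by omega) (by omega) (by omega) (by omega),
        memV' _ _ _ (by omega) (by omega) (by omega) (by omega)] at h
      refine Finset.mem_filter.2 ⟨?_, fun he => h ?_⟩
      · simp only [hI, Finset.mem_product, Finset.mem_Icc]
        omega
      · have : pr (x, y - 1) = ((pr (x, y)).1, (pr (x, y)).2 - 1) := by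
          simp only [hpr]
          push_cast
          ring_nf
        rw [he, this])
  have hcard : (Finset.univ.filter (fun v : Site L => τ v ∈ W)).card ≤ V.card := by
    refine (Finset.card_le_card (t := V.image (fun v => (pr v.1, v.2))) ?_).trans
      Finset.card_image_le
    rintro ⟨⟨i, j⟩, b⟩ hv
    replace hv := (Finset.mem_filter.1 hv).2
    have e : pr (((i - i0).val : ℤ), ((j - j0).val : ℤ)) = (i, j) := by
      simp [hpr]
    refine Finset.mem_image.2 ⟨((((i - i0).val : ℤ), ((j - j0).val : ℤ)), b), ?_, by rw [e]⟩
    have l1 := ZMod.val_lt (i - i0)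
    have l2 := ZMod.val_lt (j - j0)
    rw [memV' _ _ _ (by omega) (by omega) (by omega) (by omega), e]
    exact hv
  have hp : F0.card + F1.card + F2.card ≤ Ham L q τ := by
    rw [Ham_eq hL]
    omega
  have := Nat.pow_le_pow_left hp 2
  omega

end Cross


section Rows

theorem dd_tri {α : Type*} (x y z : α) : dd x z ≤ dd x y + dd y z := by
  by_cases h : x = y
  · subst h; simp [dd_self]
  · rw [dd_of_ne h]; have := dd_le_one x z; omega

theorem chg_Ico {α : Type*} (g : ℕ → α) {m n : ℕ} (h : m ≤ n) :
    dd (g m) (g n) ≤ ∑ k ∈ Finset.Ico m n, dd (g k) (g (k + 1)) := by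
  induction n, h using Nat.le_induction with
  | base => simp [dd_self]
  | succ n hmn ih =>
    rw [Finset.sum_Ico_succ_top hmn]
    exact (dd_tri _ (g n) _).trans (by omega)

theorem chg4 {α : Type*} (g : ℕ → α) {M n1 n2 n3 n4 : ℕ} (hp : g M = g 0)
    (h12 : n1 ≤ n2) (h23 : n2 ≤ n3) (h34 : n3 ≤ n4) (h4 : n4 ≤ M) :
    dd (g n1) (g n2) + dd (g n2) (g n3) + dd (g n3) (g n4) + dd (g n4) (g n1) ≤
      ∑ k ∈ Finset.range M, dd (g k) (g (k + 1)) := by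
  have a0 := chg_Ico g (Nat.zero_le n1)
  have a1 := chg_Ico g h12
  have a2 := chg_Ico g h23
  have a3 := chg_Ico g h34
  have a4 := chg_Ico g h4
  rw [hp] at a4
  have t := dd_tri (g n4) (g 0) (g n1)
  have s1 := Finset.sum_Ico_consecutive (fun k => dd (g k) (g (k + 1))) (Nat.zero_le n1) h12
  have s2 := Finset.sum_Ico_consecutive (fun k => dd (g k) (g (k + 1))) (Nat.zero_le n2) h23
  have s3 := Finset.sum_Ico_consecutive (fun k => dd (g k) (g (k + 1))) (Nat.zero_le n3) h34
  have s4 := Finset.sum_Ico_consecutive (fun k => dd (g k) (g (k + 1))) (Nat.zero_le n4) h4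
  rw [Finset.range_eq_Ico]
  omega

theorem chg3 {α : Type*} (g : ℕ → α) {M n1 n2 n3 : ℕ} (hp : g M = g 0)
    (h1 : n1 ≤ M) (h2 : n2 ≤ M) (h3 : n3 ≤ M) :
    dd (g n1) (g n2) + dd (g n2) (g n3) + dd (g n3) (g n1) ≤
      ∑ k ∈ Finset.range M, dd (g k) (g (k + 1)) := by
  have c12 := dd_comm (g n1) (g n2)
  have c13 := dd_comm (g n1) (g n3)
  have c23 := dd_comm (g n2) (g n3)
  have s1 := dd_self (g n1)
  have s2 := dd_self (g n2)
  have s3 := dd_self (g n3)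
  rcases le_total n1 n2 with a | a <;> rcases le_total n2 n3 with b | b <;>
    rcases le_total n1 n3 with c | c
  · have := chg4 g hp a b (le_refl n3) h3; omega
  · have := chg4 g hp a b (le_refl n3) h3; omega
  · have := chg4 g hp c b (le_refl n2) h2; omega
  · have := chg4 g hp c a (le_refl n2) h2; omega
  · have := chg4 g hp a c (le_refl n3) h3; omega
  · have := chg4 g hp b c (le_refl n1) h1; omega
  · have := chg4 g hp b a (le_refl n1) h1; omega
  · have := chg4 g hp b a (le_refl n1) h1; omega

theorem sum_range_double (f : ℕ → ℕ) (n : ℕ) :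
    ∑ k ∈ Finset.range (2 * n), f k = ∑ k ∈ Finset.range n, (f (2 * k) + f (2 * k + 1)) := by
  induction n with
  | zero => simp
  | succ n ih =>
    rw [show 2 * (n + 1) = 2 * n + 1 + 1 by ring, Finset.sum_range_succ, Finset.sum_range_succ,
      ih, Finset.sum_range_succ]
    ring

variable {L q : ℕ}

theorem sum_zmod [NeZero L] (h : ZMod L → ℕ) (i0 : ZMod L) :
    ∑ k ∈ Finset.range L, h (i0 + (k : ZMod L)) = ∑ i, h i := by
  refine Finset.sum_bij (fun k _ => i0 + (k : ZMod L)) (fun _ _ => Finset.mem_univ _) ?_ ?_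
    (fun _ _ => rfl)
  · intro a ha b hb hab
    rw [Finset.mem_range] at ha hb
    have := add_left_cancel hab
    have h2 := congrArg ZMod.val this
    rwa [ZMod.val_natCast_of_lt ha, ZMod.val_natCast_of_lt hb] at h2
  · intro i _
    exact ⟨(i - i0).val, Finset.mem_range.2 (ZMod.val_lt _), by simp⟩

/-- Linear enumeration of a row. -/
def lin (τ : Conf L q) (i0 j : ZMod L) (n : ℕ) : Fin q :=
  τ ((i0 + ((n / 2 : ℕ) : ZMod L), j), decide (n % 2 = 1))

theorem lin_even (τ : Conf L q) (i0 j : ZMod L) (k : ℕ) :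
    lin τ i0 j (2 * k) = τ ((i0 + (k : ZMod L), j), false) := by
  have h1 : 2 * k / 2 = k := by omega
  have h2 : 2 * k % 2 = 0 := by omega
  simp [lin, h1, h2]

theorem lin_odd (τ : Conf L q) (i0 j : ZMod L) (k : ℕ) :
    lin τ i0 j (2 * k + 1) = τ ((i0 + (k : ZMod L), j), true) := by
  have h1 : (2 * k + 1) / 2 = k := by omega
  have h2 : (2 * k + 1) % 2 = 1 := by omega
  simp [lin, h1, h2]

theorem lin_period (τ : Conf L q) (i0 j : ZMod L) : lin τ i0 j (2 * L) = lin τ i0 j 0 := by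
  have := lin_even τ i0 j 0
  rw [lin_even]
  simp at this ⊢
  exact this.symm

theorem rowE_lin [NeZero L] (τ : Conf L q) (i0 j : ZMod L) :
    ∑ k ∈ Finset.range (2 * L), dd (lin τ i0 j k) (lin τ i0 j (k + 1)) = rowE τ j := by
  rw [sum_range_double]
  have : ∀ k : ℕ, lin τ i0 j (2 * k + 1 + 1) = τ ((i0 + (k : ZMod L) + 1, j), false) := by
    intro k
    rw [show 2 * k + 1 + 1 = 2 * (k + 1) by ring, lin_even]
    push_cast
    rw [add_assoc]
  simp only [lin_even, lin_odd, this]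
  rw [sum_zmod (fun i => dd (τ ((i, j), false)) (τ ((i, j), true)) +
    dd (τ ((i, j), true)) (τ ((i + 1, j), false)))]
  unfold rowE
  rw [Finset.sum_add_distrib, Finset.sum_add_distrib]
  congr 1
  refine Fintype.sum_equiv (Equiv.addRight 1) _ _ ?_
  intro i
  simp [dd_comm]

/-- Position of a site in the linear enumeration of its row. -/
def pos (i0 : ZMod L) (i : ZMod L) (b : Bool) : ℕ := 2 * (i - i0).val + (if b then 1 else 0)

theorem pos_lt [NeZero L] (i0 i : ZMod L) (b : Bool) : pos i0 i b < 2 * L := by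
  have := ZMod.val_lt (i - i0)
  unfold pos
  split <;> omega

theorem lin_pos [NeZero L] (τ : Conf L q) (i0 j i : ZMod L) (b : Bool) :
    lin τ i0 j (pos i0 i b) = τ ((i, j), b) := by
  cases b
  · simp only [pos, Bool.false_eq_true, if_false, add_zero]
    rw [lin_even]; simp
  · simp only [pos, if_true]
    rw [lin_odd]; simp

theorem row_ge3 [NeZero L] (τ : Conf L q) (j i1 i2 i3 : ZMod L) (b1 b2 b3 : Bool) :
    dd (τ ((i1, j), b1)) (τ ((i2, j), b2)) + dd (τ ((i2, j), b2)) (τ ((i3, j), b3)) +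
      dd (τ ((i3, j), b3)) (τ ((i1, j), b1)) ≤ rowE τ j := by
  rw [← rowE_lin τ 0 j, ← lin_pos τ 0 j i1, ← lin_pos τ 0 j i2, ← lin_pos τ 0 j i3]
  exact chg3 _ (lin_period τ 0 j) (pos_lt _ _ _).le (pos_lt _ _ _).le (pos_lt _ _ _).le

theorem row_ge2 [NeZero L] (τ : Conf L q) {j i1 i2 : ZMod L} {b1 b2 : Bool}
    (h : τ ((i1, j), b1) ≠ τ ((i2, j), b2)) : 2 ≤ rowE τ j := by
  have := row_ge3 τ j i1 i2 i2 b1 b2 b2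
  rw [dd_of_ne h, dd_of_ne (Ne.symm h), dd_self] at this
  omega

theorem row_three [NeZero L] (τ : Conf L q) {j i1 i2 i3 : ZMod L} {b1 b2 b3 : Bool}
    (h12 : τ ((i1, j), b1) ≠ τ ((i2, j), b2)) (h23 : τ ((i2, j), b2) ≠ τ ((i3, j), b3))
    (h31 : τ ((i3, j), b3) ≠ τ ((i1, j), b1)) : 3 ≤ rowE τ j := by
  have := row_ge3 τ j i1 i2 i3 b1 b2 b3
  rw [dd_of_ne h12, dd_of_ne h23, dd_of_ne h31] at this
  omega

theorem rowK_of_lt [NeZero L] (τ : Conf L q) {j : ZMod L} (h : rowE τ j < 2) : RowK τ j := by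
  refine ⟨τ ((0, j), false), fun i b => ?_⟩
  by_contra hne
  have := row_ge2 τ hne
  omega

theorem rowE_zero_of_rowK [NeZero L] (τ : Conf L q) {j : ZMod L} (h : RowK τ j) :
    rowE τ j = 0 := by
  obtain ⟨a, ha⟩ := h
  unfold rowE
  simp [ha _ _, dd_self]

theorem two_le_of_not_rowK [NeZero L] (τ : Conf L q) {j : ZMod L} (h : ¬ RowK τ j) :
    2 ≤ rowE τ j := by
  by_contra hc
  exact h (rowK_of_lt τ (by omega))

theorem val_sub_add [NeZero L] (n1 n : ℕ) (hn1 : n1 < L) (hn : n < L) :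
    (((n : ZMod L) - (n1 : ZMod L)).val = if n1 ≤ n then n - n1 else n + L - n1) := by
  split_ifs with h
  · rw [← Nat.cast_sub h]
    exact ZMod.val_natCast_of_lt (by omega)
  · have : (n : ZMod L) - (n1 : ZMod L) = ((n + L - n1 : ℕ) : ZMod L) := by
      rw [Nat.cast_sub (by omega)]; simp
    rw [this]
    exact ZMod.val_natCast_of_lt (by omega)

theorem cyc_interval [NeZero L] {α : Type*} (f : ZMod L → α) {a b : α} (hab : a ≠ b)
    (x y : ZMod L) (hx : f x = a) (hy : f y = b) (hch : ∑ j, dd (f j) (f (j + 1)) ≤ 2) :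
    ∃ (s : ZMod L) (m : ℕ), ∀ j, f j = if (j - s).val < m then a else b := by
  have hL := Nat.pos_of_ne_zero (NeZero.ne L)
  set g : ℕ → α := fun n => f (y + (n : ZMod L)) with hg
  have gf : ∀ j, f j = g (j - y).val := by intro j; simp [hg]
  have g0 : g 0 = b := by simp [hg, hy]
  have gL : g L = g 0 := by simp [hg]
  have hs : ∑ k ∈ Finset.range L, dd (g k) (g (k + 1)) ≤ 2 := by
    have := sum_zmod (fun j => dd (f j) (f (j + 1))) y
    rw [← this] at hch
    simpa [hg, add_assoc] using hch
  have hex : ∃ n, g n = a ∧ n < L := ⟨(x - y).val, by rw [← gf]; exact hx, ZMod.val_lt _⟩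
  set S := (Finset.range L).filter (fun n => g n = a) with hS
  have hSne : S.Nonempty := by
    obtain ⟨n, h1, h2⟩ := hex
    exact ⟨n, by simp [hS, h1, h2]⟩
  set n1 := S.min' hSne with hn1
  set n2 := S.max' hSne with hn2
  have m1 : n1 < L ∧ g n1 = a := by
    have := S.min'_mem hSne
    rw [← hn1] at this
    simpa [hS] using this
  have m2 : n2 < L ∧ g n2 = a := by
    have := S.max'_mem hSne
    rw [← hn2] at this
    simpa [hS] using this
  have le1 : ∀ n, n < L → g n = a → n1 ≤ n ∧ n ≤ n2 := by
    intro n h1 h2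
    have : n ∈ S := by simp [hS, h1, h2]
    exact ⟨S.min'_le _ this, S.le_max' _ this⟩
  have other : ∀ n, n < L → g n ≠ a → g n = b := by
    intro n h1 h2
    by_contra h3
    have := chg3 g gL hL.le m1.1.le h1.le
    rw [g0, m1.2, dd_of_ne hab.symm, dd_of_ne (Ne.symm h2), dd_of_ne h3] at this
    omega
  have mid : ∀ n, n1 ≤ n → n ≤ n2 → g n = a := by
    intro n h1 h2
    by_contra h3
    have := chg4 g gL (Nat.zero_le _) h1 h2 m2.1.le
    rw [g0, m1.2, m2.2, dd_of_ne hab.symm, dd_of_ne (Ne.symm h3), dd_of_ne h3,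
      dd_of_ne hab] at this
    omega
  refine ⟨y + (n1 : ZMod L), n2 - n1 + 1, fun j => ?_⟩
  have hjl := ZMod.val_lt (j - y)
  have hv : (j - (y + (n1 : ZMod L))).val =
      if n1 ≤ (j - y).val then (j - y).val - n1 else (j - y).val + L - n1 := by
    rw [← val_sub_add n1 (j - y).val m1.1 hjl]
    congr 1
    simp
    ring
  rw [gf, hv]
  generalize (j - y).val = n at *
  have h12 : n1 ≤ n2 := (le1 n1 m1.1 m1.2).2
  by_cases hn : g n = a
  · have := le1 n hjl hn
    rw [if_pos this.1, if_pos (by omega), hn]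
  · have hnot : ¬ (n1 ≤ n ∧ n ≤ n2) := fun h => hn (mid n h.1 h.2)
    rw [other n hjl hn, if_neg]
    split_ifs <;> omega

theorem row_sample_up [NeZero L] (τ : Conf L q) (j : ZMod L) :
    ∑ i, dd (τ ((i, j), false)) (τ ((i + 1, j), false)) ≤ rowE τ j := by
  rw [← rowE_lin τ 0 j, sum_range_double, ← sum_zmod _ (0 : ZMod L)]
  refine Finset.sum_le_sum fun k _ => ?_
  have e1 := lin_even τ 0 j k
  have e2 := lin_even τ 0 j (k + 1)
  rw [Nat.cast_add, Nat.cast_one, ← add_assoc] at e2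
  rw [← e1, ← e2, show 2 * (k + 1) = 2 * k + 1 + 1 by ring]
  exact dd_tri _ _ _

end Rows


section Structure

variable {L q : ℕ}

/-- Number of sites whose spin lies in `A`. -/
noncomputable def cA [NeZero L] (τ : Conf L q) (A : Finset (Fin q)) : ℕ :=
  (Finset.univ.filter (fun v : Site L => τ v ∈ A)).card

theorem cA_comp [NeZero L] (τ : Conf L q) (A : Finset (Fin q)) (e : Site L ≃ Site L) :
    cA (τ ∘ e) A = cA τ A := by
  unfold cA
  rw [Finset.card_filter, Finset.card_filter]
  exact e.sum_comp (fun v => if τ v ∈ A then 1 else 0)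

theorem card_site [NeZero L] : Fintype.card (Site L) = 2 * L ^ 2 := by
  simp [Site, ZMod.card]
  ring

theorem cA_compl [NeZero L] (τ : Conf L q) (A : Finset (Fin q)) :
    cA τ A + cA τ Aᶜ = 2 * L ^ 2 := by
  unfold cA
  rw [← card_site, ← Finset.card_univ, ← Finset.card_filter_add_card_filter_not (s := Finset.univ)
    (fun v : Site L => τ v ∈ A)]
  simp

theorem sum_spinCount [NeZero L] (τ : Conf L q) (A : Finset (Fin q)) :
    ∑ a ∈ A, spinCount L q τ a = cA τ A := by
  unfold spinCount cA
  rw [Finset.card_eq_sum_card_fiberwise (f := τ) (t := A)]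
  · refine Finset.sum_congr rfl fun a ha => ?_
    rw [Nat.card_eq_fintype_card, Fintype.card_subtype, Finset.filter_filter]
    congr 1
    ext v
    simp only [Finset.mem_filter, Finset.mem_univ, true_and]
    constructor
    · rintro rfl; exact ⟨ha, rfl⟩
    · exact fun h => h.2
  · intro v hv
    simpa using hv

/-- There are a constant row with spin in `A` and one with spin outside `A`. -/
def HasAB (τ : Conf L q) (A : Finset (Fin q)) : Prop :=
  ∃ j1 j2 a b, a ∈ A ∧ b ∉ A ∧ RowC τ j1 a ∧ RowC τ j2 b

theorem no_cross [NeZero L] (hL : 8 ≤ L) (τ : Conf L q) (A : Finset (Fin q))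
    (hH : (Ham L q τ + 1) ^ 2 < 6 * L ^ 2) (c1 : L ^ 2 ≤ cA τ A + 1) (c2 : cA τ A ≤ L ^ 2)
    {i j : ZMod L} {a b : Fin q} (hr : RowC τ j a) (hc : RowC (τ ∘ sw) i b) : False := by
  have hab : a = b := by
    rw [← hr i false]
    exact hc j false
  subst hab
  have key : ∀ W : Finset (Fin q), a ∉ W → L ^ 2 ≤ cA τ W + 1 → False := by
    intro W hW hcW
    have := cross_bound (by omega) τ i j W (fun i b => by rw [hr]; exact hW)
      (fun j b => by rw [← hc j b] at hW; exact hW)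
    change 6 * cA τ W ≤ _ at this
    have h64 : 8 * 8 ≤ L ^ 2 := by nlinarith
    have h4 : Ham L q τ < 4 := by nlinarith
    have h16 : Ham L q τ ^ 2 ≤ 4 ^ 2 := Nat.pow_le_pow_left h4.le 2
    omega
  by_cases ha : a ∈ A
  · refine key Aᶜ (by simpa using ha) ?_
    have := cA_compl τ A
    omega
  · exact key A ha c1

theorem no_cross_diag [NeZero L] (hL : 8 ≤ L) (τ : Conf L q) (A : Finset (Fin q))
    (hH : (Ham L q τ + 1) ^ 2 < 6 * L ^ 2) (c1 : L ^ 2 ≤ cA τ A + 1) (c2 : cA τ A ≤ L ^ 2)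
    {k j : ZMod L} {a b : Fin q} (hr : RowC τ j a) (hc : RowC (τ ∘ tw) k b) : False := by
  have h2 : 2 ≤ L := by omega
  refine no_cross hL ((τ ∘ sw) ∘ tw) A ?_ ?_ ?_ (j := k) (i := j) (a := b) (b := a) ?_ ?_
  · rwa [Ham_tw h2, Ham_sw h2]
  · rwa [cA_comp, cA_comp]
  · rwa [cA_comp, cA_comp]
  · intro i c
    cases c
    · rw [← hc (-i - k) false]
      simp only [Function.comp, tw_up, sw_apply]
      congr 3
      ring
    · rw [← hc (-i - k - 1) true]
      simp only [Function.comp, tw_down, sw_apply]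
      congr 3
      ring
  · intro i c
    cases c
    · simp only [Function.comp, tw_up, sw_apply]
      exact hr _ _
    · simp only [Function.comp, tw_down, sw_apply]
      exact hr _ _

theorem totE_ge [NeZero L] (τ : Conf L q) (h : ∀ j, ¬ RowK τ j) : 2 * L ≤ totE τ := by
  unfold totE
  have : ∑ j : ZMod L, 2 ≤ ∑ j : ZMod L, rowE τ j :=
    Finset.sum_le_sum fun j _ => two_le_of_not_rowK τ (h j)
  simp [ZMod.card] at this
  omega

theorem nonconst_card [NeZero L] (τ : Conf L q) :
    2 * (Finset.univ.filter (fun j => ¬ RowK τ j)).card ≤ totE τ := by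
  unfold totE
  rw [mul_comm, ← smul_eq_mul, ← Finset.sum_const]
  refine (Finset.sum_le_sum (g := fun j => rowE τ j) fun j hj => ?_).trans
    (Finset.sum_le_sum_of_subset (Finset.filter_subset _ _))
  exact two_le_of_not_rowK τ (Finset.mem_filter.1 hj).2

theorem nonconst_bound [NeZero L] (τ : Conf L q) (W : Finset (Fin q))
    (h : ∀ j a, RowC τ j a → a ∉ W) : cA τ W ≤ L * totE τ := by
  have h1 : cA τ W ≤ ((Finset.univ.filter (fun j => ¬ RowK τ j)) ×ˢ
      (Finset.univ : Finset (ZMod L × Bool))).card := by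
    unfold cA
    refine Finset.card_le_card_of_injOn (fun v => (v.1.2, (v.1.1, v.2))) ?_ ?_
    · rintro ⟨⟨i, j⟩, b⟩ hv
      have hv := (Finset.mem_filter.1 hv).2
      simp only [Finset.coe_product, Set.mem_prod, Finset.coe_filter, Finset.mem_univ, true_and,
        Set.mem_ofPred_eq, Finset.coe_univ, Set.mem_univ, and_true]
      rintro ⟨a, ha⟩
      rw [ha i b] at hv
      exact h j a ha hv
    · rintro ⟨⟨i, j⟩, b⟩ _ ⟨⟨i', j'⟩, b'⟩ _ he
      simp only [Prod.mk.injEq] at he ⊢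
      tauto
  rw [Finset.card_product, Finset.card_univ] at h1
  simp only [Fintype.card_prod, ZMod.card, Fintype.card_bool] at h1
  have := nonconst_card τ
  nlinarith

theorem hasAB_of_row [NeZero L] (hL : 8 ≤ L) (τ : Conf L q) (A : Finset (Fin q))
    (hH : (Ham L q τ + 1) ^ 2 < 6 * L ^ 2) (c1 : L ^ 2 ≤ cA τ A + 1) (c2 : cA τ A ≤ L ^ 2)
    (hex : ∃ j, RowK τ j) : HasAB τ A := by
  obtain ⟨j, a, hr⟩ := hex
  have t1 := totE_ge (τ ∘ sw) (fun i ⟨b, hb⟩ => no_cross hL τ A hH c1 c2 hr hb)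
  have t2 := totE_ge (τ ∘ tw) (fun i ⟨b, hb⟩ => no_cross_diag hL τ A hH c1 c2 hr hb)
  have t3 := two_Ham (by omega) τ
  have key : ∀ W : Finset (Fin q), L ^ 2 ≤ cA τ W + 1 → ∃ j a, RowC τ j a ∧ a ∈ W := by
    intro W hW
    by_contra hno
    push Not at hno
    have := nonconst_bound τ W hno
    have h5 : 5 * L ^ 2 ≤ 2 * L * (Ham L q τ + 1) := by nlinarith
    have h6 := Nat.pow_le_pow_left h5 2
    have h7 : 0 < L ^ 2 := by positivity
    have h8 : (2 * L) ^ 2 * (Ham L q τ + 1) ^ 2 ≤ (2 * L) ^ 2 * (6 * L ^ 2) :=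
      Nat.mul_le_mul_left _ hH.le
    nlinarith
  obtain ⟨j1, a, h1, ha⟩ := key A c1
  obtain ⟨j2, b, h2, hb⟩ := key Aᶜ (by have := cA_compl τ A; omega)
  exact ⟨j1, j2, a, b, ha, by simpa using hb, h1, h2⟩

theorem structure_thm [NeZero L] (hL : 8 ≤ L) (τ : Conf L q) (A : Finset (Fin q))
    (hH : (Ham L q τ + 1) ^ 2 < 6 * L ^ 2) (c1 : L ^ 2 ≤ cA τ A + 1) (c2 : cA τ A ≤ L ^ 2) :
    HasAB τ A ∨ HasAB (τ ∘ sw) A ∨ HasAB (τ ∘ tw) A := by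
  have h2 : 2 ≤ L := by omega
  by_cases e1 : ∃ j, RowK τ j
  · exact Or.inl (hasAB_of_row hL τ A hH c1 c2 e1)
  by_cases e2 : ∃ j, RowK (τ ∘ sw) j
  · refine Or.inr (Or.inl (hasAB_of_row hL (τ ∘ sw) A ?_ ?_ ?_ e2))
    · rwa [Ham_sw h2]
    · rwa [cA_comp]
    · rwa [cA_comp]
  by_cases e3 : ∃ j, RowK (τ ∘ tw) j
  · refine Or.inr (Or.inr (hasAB_of_row hL (τ ∘ tw) A ?_ ?_ ?_ e3))
    · rwa [Ham_tw h2]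
    · rwa [cA_comp]
    · rwa [cA_comp]
  push Not at e1 e2 e3
  have t1 := totE_ge _ e1
  have t2 := totE_ge _ e2
  have t3 := totE_ge _ e3
  have t4 := two_Ham h2 τ
  have : 3 * L ≤ Ham L q τ := by omega
  nlinarith

/-- Columns of a configuration with two different constant rows have energy at least two. -/
theorem col_ge [NeZero L] {τ : Conf L q} {j1 j2 : ZMod L} {a b : Fin q} (hab : a ≠ b)
    (h1 : RowC τ j1 a) (h2 : RowC τ j2 b) (i : ZMod L) : 2 ≤ rowE (τ ∘ sw) i := by
  refine row_ge2 (τ ∘ sw) (i1 := j1) (i2 := j2) (b1 := false) (b2 := false) ?_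
  simp only [Function.comp, sw_apply, h1 _ _, h2 _ _]
  exact hab

theorem diag_ge [NeZero L] {τ : Conf L q} {j1 j2 : ZMod L} {a b : Fin q} (hab : a ≠ b)
    (h1 : RowC τ j1 a) (h2 : RowC τ j2 b) (k : ZMod L) : 2 ≤ rowE (τ ∘ tw) k := by
  refine row_ge2 (τ ∘ tw) (i1 := -k - j1) (i2 := -k - j2) (b1 := false) (b2 := false) ?_
  have e1 : -(-k - j1) - k = j1 := by ring
  have e2 : -(-k - j2) - k = j2 := by ring
  simp only [Function.comp, tw_up, e1, e2, h1 _ _, h2 _ _]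
  exact hab

theorem totE_le [NeZero L] (hL : 2 ≤ L) {τ : Conf L q} {j1 j2 : ZMod L} {a b : Fin q}
    (hab : a ≠ b) (h1 : RowC τ j1 a) (h2 : RowC τ j2 b) : totE τ + 4 * L ≤ 2 * Ham L q τ := by
  have t1 : ∑ j : ZMod L, 2 ≤ totE (τ ∘ sw) := Finset.sum_le_sum fun j _ => col_ge hab h1 h2 j
  have t2 : ∑ j : ZMod L, 2 ≤ totE (τ ∘ tw) := Finset.sum_le_sum fun j _ => diag_ge hab h1 h2 j
  have t3 := two_Ham hL τ
  simp [ZMod.card] at t1 t2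
  omega

end Structure


section Paths

variable {L q : ℕ}

theorem sum_dd_le {ι α : Type*} [Fintype ι] (f g : ι → α) (S : Finset ι)
    (h : ∀ p, f p ≠ g p → p ∈ S) : ∑ p, dd (f p) (g p) ≤ S.card := by
  rw [Finset.card_eq_sum_ones,
    ← Finset.sum_subset (Finset.subset_univ S) (fun p _ hp => ?_)]
  · exact Finset.sum_le_sum fun p _ => dd_le_one _ _
  · by_contra hc
    exact hp (h p fun e => hc (dd_eq_zero.2 e))

/-- Position of a site when the torus is filled row by row. -/
def idx (l0 i0 : ZMod L) (v : Site L) : ℕ := 2 * (L * (v.1.2 - l0).val) + pos i0 v.1.1 v.2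

/-- The configuration in which the first `N` sites have spin `a`, the other ones `b`. -/
def G (l0 i0 : ZMod L) (a b : Fin q) (N : ℕ) : Conf L q :=
  fun v => if idx l0 i0 v < N then a else b

theorem G_ne {l0 i0 : ZMod L} {a b : Fin q} {N : ℕ} {v w : Site L}
    (h : G l0 i0 a b N v ≠ G l0 i0 a b N w) :
    ¬ (idx l0 i0 v < N ↔ idx l0 i0 w < N) := by
  intro h2
  apply h
  simp only [G, h2]

theorem val_pred [NeZero L] (z : ZMod L) :
    (z - 1).val = if z.val = 0 then L - 1 else z.val - 1 := by
  have hz := ZMod.val_lt z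
  have hc : ((z.val : ℕ) : ZMod L) = z := ZMod.natCast_zmod_val z
  split_ifs with h
  · have : z - 1 = ((L - 1 : ℕ) : ZMod L) := by
      rw [h, Nat.cast_zero] at hc
      rw [← hc, Nat.cast_sub (by omega)]
      simp
    rw [this]
    exact ZMod.val_natCast_of_lt (by omega)
  · have : z - 1 = ((z.val - 1 : ℕ) : ZMod L) := by
      rw [Nat.cast_sub (by omega), hc]
      simp
    rw [this]
    exact ZMod.val_natCast_of_lt (by omega)

theorem divmod_eq {L N Y r : ℕ} (h : N = 2 * (L * Y) + r) (hr : r < 2 * L) :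
    N / (2 * L) = Y ∧ N % (2 * L) = r := by
  have h' : N = r + 2 * L * Y := by rw [h]; ring
  rw [h']
  constructor
  · rw [Nat.add_mul_div_left _ _ (by omega), Nat.div_eq_of_lt hr, zero_add]
  · rw [Nat.add_mul_mod_self_left, Nat.mod_eq_of_lt hr]

theorem eq_add_val [NeZero L] (z l0 : ZMod L) {Y : ℕ} (h : Y = (z - l0).val) :
    z = l0 + (Y : ZMod L) := by
  rw [h]; simp

theorem idx_up (l0 i0 i j : ZMod L) :
    idx l0 i0 ((i, j), false) = 2 * (L * (j - l0).val) + 2 * (i - i0).val := by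
  simp [idx, pos]

theorem idx_down (l0 i0 i j : ZMod L) :
    idx l0 i0 ((i, j), true) = 2 * (L * (j - l0).val) + (2 * (i - i0).val + 1) := by
  simp [idx, pos]

theorem E0_G [NeZero L] (l0 i0 : ZMod L) (a b : Fin q) (N : ℕ) :
    E0 (G l0 i0 a b N) ≤ if N % 2 = 1 then 1 else 0 := by
  unfold E0
  have key : ∀ p : ZMod L × ZMod L,
      G l0 i0 a b N (p, false) ≠ G l0 i0 a b N (p, true) →
      N % 2 = 1 ∧ p = (i0 + ((N % (2 * L) / 2 : ℕ) : ZMod L), l0 + ((N / (2 * L) : ℕ) : ZMod L)) := by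
    rintro ⟨i, j⟩ hp
    have h := G_ne hp
    rw [idx_up, idx_down] at h
    have hX := ZMod.val_lt (i - i0)
    have hN : N = 2 * (L * (j - l0).val) + (2 * (i - i0).val + 1) := by omega
    obtain ⟨h1, h2⟩ := divmod_eq hN (by omega)
    refine ⟨by omega, ?_⟩
    rw [Prod.mk.injEq]
    exact ⟨eq_add_val i i0 (by omega), eq_add_val j l0 h1⟩
  split_ifs with hN
  · refine (sum_dd_le _ _ {(i0 + ((N % (2 * L) / 2 : ℕ) : ZMod L),
      l0 + ((N / (2 * L) : ℕ) : ZMod L))} fun p hp => ?_).trans (Finset.card_singleton _).le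
    exact Finset.mem_singleton.2 (key p hp).2
  · refine (sum_dd_le _ _ ∅ fun p hp => ?_).trans Finset.card_empty.le
    exact absurd (key p hp).1 hN

theorem E1_G [NeZero L] (l0 i0 : ZMod L) (a b : Fin q) (N : ℕ) :
    E1 (G l0 i0 a b N) ≤ if N % 2 = 1 then 1 else 2 := by
  unfold E1
  have key : ∀ p : ZMod L × ZMod L,
      G l0 i0 a b N (p, false) ≠ G l0 i0 a b N ((p.1 - 1, p.2), true) →
      p = (i0, l0 + ((N / (2 * L) : ℕ) : ZMod L)) ∨
      (N % 2 = 0 ∧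
      p = (i0 + ((N % (2 * L) / 2 : ℕ) : ZMod L), l0 + ((N / (2 * L) : ℕ) : ZMod L))) := by
    rintro ⟨i, j⟩ hp
    have h := G_ne hp
    dsimp only at h
    rw [idx_up, idx_down, show i - 1 - i0 = i - i0 - 1 by ring, val_pred] at h
    have hX := ZMod.val_lt (i - i0)
    split_ifs at h with h0
    · left
      rw [h0] at h
      have hi : i = i0 := by simpa using eq_add_val i i0 h0.symm
      obtain ⟨h1, h2⟩ := divmod_eq (L := L) (N := N) (Y := (j - l0).val)
        (r := N - 2 * (L * (j - l0).val)) (by omega) (by omega)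
      rw [Prod.mk.injEq]
      exact ⟨hi, eq_add_val j l0 h1⟩
    · right
      have hN : N = 2 * (L * (j - l0).val) + (2 * (i - i0).val) := by omega
      obtain ⟨h1, h2⟩ := divmod_eq hN (by omega)
      refine ⟨by omega, ?_⟩
      rw [Prod.mk.injEq]
      exact ⟨eq_add_val i i0 (by omega), eq_add_val j l0 h1⟩
  split_ifs with hN
  · refine (sum_dd_le _ _ {(i0, l0 + ((N / (2 * L) : ℕ) : ZMod L))} fun p hp => ?_).trans
      (Finset.card_singleton _).le
    rw [Finset.mem_singleton]
    rcases key p hp with h1 | ⟨h1, _⟩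
    · exact h1
    · omega
  · refine (sum_dd_le _ _ {(i0, l0 + ((N / (2 * L) : ℕ) : ZMod L)),
      (i0 + ((N % (2 * L) / 2 : ℕ) : ZMod L), l0 + ((N / (2 * L) : ℕ) : ZMod L))}
      fun p hp => ?_).trans Finset.card_le_two
    rw [Finset.mem_insert, Finset.mem_singleton]
    exact (key p hp).imp id (fun h => h.2)

theorem E2_G [NeZero L] (l0 i0 : ZMod L) (a b : Fin q) (N : ℕ) :
    E2 (G l0 i0 a b N) ≤ 2 * L := by
  unfold E2
  have key : ∀ p : ZMod L × ZMod L,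
      G l0 i0 a b N (p, false) ≠ G l0 i0 a b N ((p.1, p.2 - 1), true) →
      p ∈ (Finset.univ.image (fun i : ZMod L => (i, l0))) ∪
      (Finset.univ.image (fun i : ZMod L =>
        (i, l0 + (((N - 2 * (i - i0).val + 2 * L - 1) / (2 * L) : ℕ) : ZMod L)))) := by
    rintro ⟨i, j⟩ hp
    have h := G_ne hp
    dsimp only at h
    rw [idx_up, idx_down, show j - 1 - l0 = j - l0 - 1 by ring, val_pred] at h
    have hX := ZMod.val_lt (i - i0)
    rw [Finset.mem_union, Finset.mem_image, Finset.mem_image]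
    split_ifs at h with h0
    · left
      have hj : j = l0 := by simpa using eq_add_val j l0 h0.symm
      exact ⟨i, Finset.mem_univ _, by rw [hj]⟩
    · right
      refine ⟨i, Finset.mem_univ _, ?_⟩
      rw [Prod.mk.injEq]
      refine ⟨rfl, (eq_add_val j l0 ?_).symm⟩
      generalize (j - l0).val = Y at *
      obtain ⟨Y, rfl⟩ : ∃ Y', Y = Y' + 1 := ⟨Y - 1, by omega⟩
      rw [show Y + 1 - 1 = Y by omega, mul_add, mul_one] at h
      refine (divmod_eq (L := L) (Y := Y + 1)
        (r := N - 2 * (i - i0).val + 2 * L - 1 - 2 * (L * (Y + 1))) ?_ ?_).1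
      · rw [mul_add, mul_one]; omega
      · rw [mul_add, mul_one]; omega
  refine (sum_dd_le _ _ _ key).trans ((Finset.card_union_le _ _).trans ?_)
  have h1 : (Finset.univ.image (fun i : ZMod L => (i, l0))).card ≤ L :=
    Finset.card_image_le.trans (by simp [ZMod.card])
  have h2 : (Finset.univ.image (fun i : ZMod L =>
        (i, l0 + (((N - 2 * (i - i0).val + 2 * L - 1) / (2 * L) : ℕ) : ZMod L)))).card ≤ L :=
    Finset.card_image_le.trans (by simp [ZMod.card])
  omega

theorem Ham_G [NeZero L] (hL : 2 ≤ L) (l0 i0 : ZMod L) (a b : Fin q) (N : ℕ) :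
    Ham L q (G l0 i0 a b N) ≤ 2 * L + 2 := by
  rw [Ham_eq hL]
  have h0 := E0_G l0 i0 a b N
  have h1 := E1_G l0 i0 a b N
  have h2 := E2_G l0 i0 a b N
  split_ifs at h0 h1 <;> omega

theorem NHat_step {ζ ζ' : Conf L q} (h : ζ ∈ NHatGround L q) (hf : oneFlip ζ ζ')
    (hH : Ham L q ζ' ≤ 2 * L + 2) : ζ' ∈ NHatGround L q := by
  obtain ⟨a, N, ω, h0, hN, hs, hh⟩ := h
  refine ⟨a, N + 1, fun n => if n ≤ N then ω n else ζ', ?_, ?_, ?_, ?_⟩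
  · simp [h0]
  · simp
  · intro n hn
    by_cases h' : n < N
    · simp only [if_pos h'.le, if_pos (show n + 1 ≤ N by omega)]
      exact hs n h'
    · obtain rfl : n = N := by omega
      simpa [hN] using hf
  · intro n hn
    by_cases h' : n ≤ N
    · simp only [if_pos h']
      exact hh n h'
    · simp only [if_neg h']
      exact hH

theorem oneFlip_symm {σ ζ : Conf L q} (h : oneFlip σ ζ) : oneFlip ζ σ := by
  obtain ⟨x, h1, h2⟩ := h
  exact ⟨x, h1.symm, fun y hy => (h2 y hy).symm⟩

theorem pos_inj [NeZero L] {i0 i i' : ZMod L} {b b' : Bool} (h : pos i0 i b = pos i0 i' b') :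
    i = i' ∧ b = b' := by
  have hb : b = b' := by
    cases b <;> cases b' <;> simp [pos] at h ⊢ <;> omega
  subst hb
  have hv : (i - i0).val = (i' - i0).val := by
    simp only [pos] at h; omega
  have := ZMod.val_injective L hv
  exact ⟨sub_left_injective this, rfl⟩

theorem idx_inj [NeZero L] (l0 i0 : ZMod L) : Function.Injective (idx l0 i0) := by
  rintro ⟨⟨i, j⟩, b⟩ ⟨⟨i', j'⟩, b'⟩ h
  simp only [idx] at h
  have h1 := divmod_eq (L := L) (N := 2 * (L * (j - l0).val) + pos i0 i b) rfl (pos_lt i0 i b)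
  have h2 := divmod_eq (L := L) h (pos_lt i0 i' b')
  have hj : (j - l0).val = (j' - l0).val := h1.1.symm.trans h2.1
  have hp : pos i0 i b = pos i0 i' b' := h1.2.symm.trans h2.2
  obtain ⟨rfl, rfl⟩ := pos_inj hp
  rw [sub_left_injective (ZMod.val_injective L hj)]

theorem G_mem [NeZero L] (hL : 2 ≤ L) (l0 i0 : ZMod L) {a b : Fin q} (hab : a ≠ b) (N : ℕ) :
    G l0 i0 a b N ∈ NHatGround L q := by
  induction N with
  | zero =>
    refine ⟨b, 0, fun _ => groundConf L q b, rfl, ?_, by simp, ?_⟩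
    · funext v
      simp [G, groundConf]
    · intro n _
      have e : groundConf L q b = G 0 0 b b 0 := by
        funext v
        simp [G, groundConf]
      rw [e]
      exact Ham_G hL _ _ _ _ _
  | succ N ih =>
    by_cases h : ∃ v, idx l0 i0 v = N
    · obtain ⟨v, hv⟩ := h
      refine NHat_step ih ⟨v, ?_, ?_⟩ (Ham_G hL _ _ _ _ _)
      · simp [G, hv]
        exact hab.symm
      · intro y hy
        have : idx l0 i0 y ≠ N := fun h => hy (idx_inj l0 i0 (h.trans hv.symm))
        have e : idx l0 i0 y < N ↔ idx l0 i0 y < N + 1 := by omega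
        simp only [G, e]
    · push Not at h
      have : G l0 i0 a b (N + 1) = G l0 i0 a b N := by
        funext y
        have := h y
        have e : idx l0 i0 y < N ↔ idx l0 i0 y < N + 1 := by omega
        simp only [G, e]
      rwa [this]

theorem oneFlip_comp {σ ζ : Conf L q} (e : Site L ≃ Site L) (h : oneFlip σ ζ) :
    oneFlip (σ ∘ e) (ζ ∘ e) := by
  obtain ⟨x, h1, h2⟩ := h
  refine ⟨e.symm x, by simpa using h1, fun y hy => h2 _ ?_⟩
  rintro rfl
  simp at hy

theorem NHat_comp {ζ : Conf L q} (e : Site L ≃ Site L)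
    (he : ∀ τ : Conf L q, Ham L q (τ ∘ e) = Ham L q τ) (h : ζ ∘ e ∈ NHatGround L q) :
    ζ ∈ NHatGround L q := by
  obtain ⟨a, N, ω, h0, hN, hs, hh⟩ := h
  have back : ∀ τ : Conf L q, (τ ∘ e.symm) ∘ e = τ := by
    intro τ; funext v; simp
  refine ⟨a, N, fun n => ω n ∘ e.symm, ?_, ?_, ?_, ?_⟩
  · funext v; simp [h0, groundConf]
  · funext v; simp [hN]
  · intro n hn
    exact oneFlip_comp e.symm (hs n hn)
  · intro n hn
    rw [← he, back]
    exact hh n hn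

end Paths


section PartOne

variable {L q : ℕ}

theorem parity [NeZero L] (hL : 2 ≤ L) (τ : Conf L q) (A : Finset (Fin q)) {a b : Fin q}
    (ha : a ∈ A) (hb : b ∉ A) (h : ∀ v, τ v = a ∨ τ v = b) :
    Ham L q τ % 2 = cA τ A % 2 := by
  set w : Site L → ZMod 2 := fun v => if τ v ∈ A then 1 else 0 with hw
  have hab : a ≠ b := by rintro rfl; exact hb ha
  have hdd : ∀ v u, ((dd (τ v) (τ u) : ℕ) : ZMod 2) = w v + w u := by
    intro v u
    have two : (1 : ZMod 2) + 1 = 0 := by decide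
    rcases h v with h1 | h1 <;> rcases h u with h2 | h2 <;>
      simp [hw, h1, h2, dd_self, dd_of_ne hab, dd_of_ne hab.symm, ha, hb, two]
  have e0 : ((E0 τ : ℕ) : ZMod 2) = ∑ p, w (p, false) + ∑ p, w (p, true) := by
    unfold E0
    rw [Nat.cast_sum, ← Finset.sum_add_distrib]
    exact Finset.sum_congr rfl fun p _ => hdd _ _
  have e1 : ((E1 τ : ℕ) : ZMod 2) = ∑ p, w (p, false) + ∑ p, w (p, true) := by
    unfold E1
    rw [Nat.cast_sum, ← (Equiv.subRight ((1, 0) : ZMod L × ZMod L)).sum_comp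
      (fun p => w (p, true)), ← Finset.sum_add_distrib]
    refine Finset.sum_congr rfl fun p _ => ?_
    rw [hdd]
    congr 3
    ext <;> simp
  have e2 : ((E2 τ : ℕ) : ZMod 2) = ∑ p, w (p, false) + ∑ p, w (p, true) := by
    unfold E2
    rw [Nat.cast_sum, ← (Equiv.subRight ((0, 1) : ZMod L × ZMod L)).sum_comp
      (fun p => w (p, true)), ← Finset.sum_add_distrib]
    refine Finset.sum_congr rfl fun p _ => ?_
    rw [hdd]
    congr 3
    ext <;> simp
  have ec : ((cA τ A : ℕ) : ZMod 2) = ∑ p, w (p, false) + ∑ p, w (p, true) := by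
    unfold cA
    rw [Finset.card_filter, Nat.cast_sum, Fintype.sum_prod_type, ← Finset.sum_add_distrib]
    refine Finset.sum_congr rfl fun p _ => ?_
    rw [Fintype.sum_bool, add_comm]
    simp [hw]
  have : ((Ham L q τ : ℕ) : ZMod 2) = ((cA τ A : ℕ) : ZMod 2) := by
    rw [Ham_eq hL, Nat.cast_add, Nat.cast_add, e0, e1, e2, ec]
    generalize ∑ p, w (p, false) + ∑ p, w (p, true) = z
    revert z
    decide
  rw [ZMod.natCast_eq_natCast_iff] at this
  exact this

theorem G_of_rows [NeZero L] (τ : Conf L q) {a b : Fin q} {s : ZMod L} {m : ℕ}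
    (h : ∀ j, RowC τ j (if (j - s).val < m then a else b)) :
    τ = G s 0 a b (2 * (L * m)) := by
  funext v
  obtain ⟨⟨i, j⟩, c⟩ := v
  rw [h j i c]
  unfold G
  have hp := pos_lt 0 i c
  have : idx s 0 ((i, j), c) < 2 * (L * m) ↔ (j - s).val < m := by
    simp only [idx]
    constructor
    · intro h1
      by_contra h2
      have := Nat.mul_le_mul_left L (not_lt.1 h2)
      omega
    · intro h1
      have := Nat.mul_le_mul_left L (Nat.succ_le_of_lt h1)
      rw [Nat.mul_succ] at this
      omega
  simp only [this]

theorem col_pattern [NeZero L] (τ : Conf L q) {a b : Fin q} (hab : a ≠ b) {j1 j2 i : ZMod L}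
    (h1 : RowC τ j1 a) (h2 : RowC τ j2 b) (hi : rowE (τ ∘ sw) i ≤ 2) :
    ∃ (s : ZMod L) (m : ℕ), ∀ j, τ ((i, j), false) = if (j - s).val < m then a else b :=
  cyc_interval (fun j => τ ((i, j), false)) hab j1 j2 (h1 _ _) (h2 _ _)
    ((row_sample_up (τ ∘ sw) i).trans hi)

theorem sum_ge_one [NeZero L] (f : ZMod L → ℕ) (h : ∀ i, 2 ≤ f i) (i : ZMod L) :
    2 * L + f i ≤ ∑ j, f j + 2 := by
  have h1 := Finset.sum_erase_add Finset.univ f (Finset.mem_univ i)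
  have h2 : ∑ j ∈ Finset.univ.erase i, 2 ≤ ∑ j ∈ Finset.univ.erase i, f j :=
    Finset.sum_le_sum fun j _ => h j
  rw [Finset.sum_const, Finset.card_erase_of_mem (Finset.mem_univ i), Finset.card_univ,
    ZMod.card, smul_eq_mul] at h2
  have := Nat.pos_of_ne_zero (NeZero.ne L)
  omega

theorem sum_ge_two [NeZero L] (f : ZMod L → ℕ) (h : ∀ i, 2 ≤ f i) {i k : ZMod L} (hik : i ≠ k) :
    2 * L + f i + f k ≤ ∑ j, f j + 4 := by
  have h1 := Finset.sum_erase_add Finset.univ f (Finset.mem_univ i)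
  have h3 : f k - 2 + ∑ j ∈ Finset.univ.erase i, 2 ≤ ∑ j ∈ Finset.univ.erase i, f j := by
    have hk : k ∈ Finset.univ.erase i := by simp [hik.symm]
    rw [← Finset.sum_erase_add _ f hk, ← Finset.sum_erase_add _ (fun _ => 2) hk]
    have : ∑ j ∈ (Finset.univ.erase i).erase k, 2 ≤ ∑ j ∈ (Finset.univ.erase i).erase k, f j :=
      Finset.sum_le_sum fun j _ => h j
    have := h k
    omega
  rw [Finset.sum_const, Finset.card_erase_of_mem (Finset.mem_univ i), Finset.card_univ,
    ZMod.card, smul_eq_mul] at h3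
  have := Nat.pos_of_ne_zero (NeZero.ne L)
  have := h k
  omega

theorem rows_le_totE [NeZero L] (τ : Conf L q) {j k : ZMod L} (h : j ≠ k) :
    rowE τ j + rowE τ k ≤ totE τ := by
  unfold totE
  rw [← Finset.sum_pair h]
  exact Finset.sum_le_sum_of_subset (Finset.subset_univ _)

theorem row_le_totE [NeZero L] (τ : Conf L q) (j : ZMod L) : rowE τ j ≤ totE τ :=
  Finset.single_le_sum (f := fun j => rowE τ j) (fun _ _ => Nat.zero_le _) (Finset.mem_univ j)

theorem exists_col [NeZero L] (hL : 2 ≤ L) {τ : Conf L q} {j1 j2 : ZMod L} {a b : Fin q}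
    (hab : a ≠ b) (h1 : RowC τ j1 a) (h2 : RowC τ j2 b) (hH : 2 * Ham L q τ < 5 * L) :
    ∃ i, rowE (τ ∘ sw) i ≤ 2 := by
  by_contra hc
  push Not at hc
  have t1 : ∑ j : ZMod L, 3 ≤ totE (τ ∘ sw) := Finset.sum_le_sum fun j _ => hc j
  have t2 : ∑ j : ZMod L, 2 ≤ totE (τ ∘ tw) := Finset.sum_le_sum fun j _ => diag_ge hab h1 h2 j
  have t3 := two_Ham hL τ
  simp [ZMod.card] at t1 t2
  omega

theorem col_three [NeZero L] {τ : Conf L q} {j1 j2 : ZMod L} {a b : Fin q} (hab : a ≠ b)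
    (h1 : RowC τ j1 a) (h2 : RowC τ j2 b) {i j : ZMod L} {c : Bool}
    (ha : τ ((i, j), c) ≠ a) (hb : τ ((i, j), c) ≠ b) : 3 ≤ rowE (τ ∘ sw) i := by
  refine row_three (τ ∘ sw) (i1 := j1) (i2 := j2) (i3 := j) (b1 := false) (b2 := false)
    (b3 := c) ?_ ?_ ?_
  · simp only [Function.comp, sw_apply, h1 _ _, h2 _ _]; exact hab
  · simp only [Function.comp, sw_apply, h2 _ _]; exact hb.symm
  · simp only [Function.comp, sw_apply, h1 _ _]; exact ha

theorem diag_three [NeZero L] {τ : Conf L q} {j1 j2 : ZMod L} {a b : Fin q} (hab : a ≠ b)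
    (h1 : RowC τ j1 a) (h2 : RowC τ j2 b) {v : Site L}
    (ha : τ v ≠ a) (hb : τ v ≠ b) : 3 ≤ rowE (τ ∘ tw) (tw v).1.2 := by
  have e3 : (τ ∘ tw) (((tw v).1.1, (tw v).1.2), (tw v).2) = τ v := by
    change τ (tw (tw v)) = τ v
    congr 1
    exact tw.left_inv v
  generalize (tw v).1.2 = k at *
  refine row_three (τ ∘ tw) (i1 := -k - j1) (i2 := -k - j2) (i3 := (tw v).1.1) (b1 := false)
    (b2 := false) (b3 := (tw v).2) ?_ ?_ ?_
  · have e1 : -(-k - j1) - k = j1 := by ring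
    have e2 : -(-k - j2) - k = j2 := by ring
    simp only [Function.comp, tw_up, e1, e2, h1 _ _, h2 _ _]
    exact hab
  · have e2 : -(-k - j2) - k = j2 := by ring
    rw [e3]
    simp only [Function.comp, tw_up, e2, h2 _ _]
    exact hb.symm
  · have e1 : -(-k - j1) - k = j1 := by ring
    rw [e3]
    simp only [Function.comp, tw_up, e1, h1 _ _]
    exact ha

/-- A configuration of energy at most `2L+2` with a third spin is in `N̂`. -/
theorem third_spin [NeZero L] (hL : 8 ≤ L) {τ : Conf L q} {j1 j2 : ZMod L} {a b : Fin q}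
    (hab : a ≠ b) (h1 : RowC τ j1 a) (h2 : RowC τ j2 b) (hH : Ham L q τ ≤ 2 * L + 2)
    {y : Site L} (ya : τ y ≠ a) (yb : τ y ≠ b) : τ ∈ NHatGround L q := by
  have h2L : 2 ≤ L := by omega
  have hone := one_ne_zero_of_two_le h2L
  have cg := col_ge hab h1 h2
  have dg := diag_ge hab h1 h2
  have tH := two_Ham h2L τ
  have nothird : ∀ j c, RowC τ j c → c = a ∨ c = b := by
    intro j c hc
    by_contra hno
    push Not at hno
    obtain ⟨i, hi⟩ := exists_col h2L hab h1 h2 (by omega)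
    have := col_three hab h1 h2 (i := i) (j := j) (c := false) (by rw [hc]; exact hno.1)
      (by rw [hc]; exact hno.2)
    omega
  have nonc : ∀ v, τ v ≠ a → τ v ≠ b → 2 ≤ rowE τ v.1.2 := by
    rintro ⟨⟨i, j⟩, c⟩ ha hb
    refine two_le_of_not_rowK τ ?_
    rintro ⟨d, hd⟩
    rw [hd] at ha hb
    rcases nothird j d hd with h | h
    · exact ha h
    · exact hb h
  obtain ⟨⟨iy, jy⟩, cy⟩ := y
  have cy3 := col_three hab h1 h2 ya yb
  have dy3 := diag_three hab h1 h2 ya yb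
  have ry := nonc _ ya yb
  have s1 := sum_ge_one _ cg iy
  have s2 := sum_ge_one _ dg (tw ((iy, jy), cy)).1.2
  have tle : totE τ ≤ 2 := by unfold totE at *; omega
  have uniq : ∀ z, τ z ≠ a → τ z ≠ b → z = ((iy, jy), cy) := by
    rintro ⟨⟨i, j⟩, c⟩ ha hb
    have hj : j = jy := by
      by_contra hne
      have r1 := nonc _ ha hb
      have := rows_le_totE τ hne
      simp only at r1 ry
      omega
    subst hj
    have hi : i = iy := by
      by_contra hne
      have c3 := col_three hab h1 h2 ha hb
      have s3 := sum_ge_two _ cg hne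
      have rt := row_le_totE τ j
      simp only at ry
      unfold totE at *
      omega
    subst hi
    have hc : c = cy := by
      by_contra hne
      have d3 := diag_three hab h1 h2 ha hb
      have s3 := sum_ge_two _ dg (i := (tw ((i, j), c)).1.2) (k := (tw ((i, j), cy)).1.2) (by
        cases c <;> cases cy <;> simp at hne ⊢
        · intro h; exact hone (by linear_combination h)
        · intro h; exact hone h)
      have rt := row_le_totE τ j
      simp only at ry
      unfold totE at *
      omega
    rw [hc]
  have ry2 := row_le_totE τ jy
  simp only at ry
  have hcol : iy + 1 ≠ iy := by simpa using hone
  set c' := τ ((iy + 1, jy), false) with hc'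
  have rest : ∀ i c, ((i, jy), c) ≠ ((iy, jy), cy) → τ ((i, jy), c) = c' := by
    intro i c hne
    by_contra hdiff
    have hz : ∀ z, z ≠ ((iy, jy), cy) → τ z ≠ τ ((iy, jy), cy) := by
      intro z hz heq
      exact hz (uniq z (by rw [heq]; exact ya) (by rw [heq]; exact yb))
    have h0 : (((iy + 1, jy), false) : Site L) ≠ ((iy, jy), cy) := by
      intro h
      simp only [Prod.mk.injEq] at h
      exact hcol h.1.1
    have := row_three τ (i1 := i) (i2 := iy + 1) (i3 := iy) (j := jy) (b1 := c) (b2 := false)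
      (b3 := cy) hdiff (hz _ h0) (hz _ hne).symm
    omega
  have s3 := sum_ge_two _ cg hcol
  have hc2 : rowE (τ ∘ sw) (iy + 1) ≤ 2 := by unfold totE at *; omega
  obtain ⟨s, m, hsm⟩ := col_pattern τ hab h1 h2 hc2
  have hG : Function.update τ ((iy, jy), cy) c' = G s 0 a b (2 * (L * m)) := by
    refine G_of_rows _ fun j i c => ?_
    rw [← hsm j]
    by_cases hj : j = jy
    · subst hj
      by_cases he : (((i, j), c) : Site L) = ((iy, j), cy)
      · rw [he, Function.update_self]
      · rw [Function.update_of_ne he]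
        exact rest i c he
    · rw [Function.update_of_ne (by
        intro h
        simp only [Prod.mk.injEq] at h
        exact hj h.1.2)]
      have := rows_le_totE τ hj
      obtain ⟨d, hd⟩ := rowK_of_lt τ (j := j) (by omega)
      rw [hd, hd]
  have hmem := G_mem h2L s 0 hab (2 * (L * m))
  rw [← hG] at hmem
  refine NHat_step hmem ⟨((iy, jy), cy), ?_, ?_⟩ hH
  · rw [Function.update_self]
    intro h
    have h0 : (((iy + 1, jy), false) : Site L) ≠ ((iy, jy), cy) := by
      intro h
      simp only [Prod.mk.injEq] at h
      exact hcol h.1.1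
    refine h0 (uniq _ ?_ ?_)
    · rw [← hc', h]; exact ya
    · rw [← hc', h]; exact yb
  · intro z hz
    rw [Function.update_of_ne hz]

end PartOne


section PartOneB

variable {L q : ℕ}

/-- `a b a b` in cyclic order inside a row forces energy at least four. -/
theorem row_four [NeZero L] (τ : Conf L q) (i0 j : ZMod L) {n1 n2 n3 n4 : ℕ}
    (h12 : n1 ≤ n2) (h23 : n2 ≤ n3) (h34 : n3 ≤ n4) (h4 : n4 ≤ 2 * L)
    (d12 : lin τ i0 j n1 ≠ lin τ i0 j n2) (d23 : lin τ i0 j n2 ≠ lin τ i0 j n3)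
    (d34 : lin τ i0 j n3 ≠ lin τ i0 j n4) (d41 : lin τ i0 j n4 ≠ lin τ i0 j n1) :
    4 ≤ rowE τ j := by
  have := chg4 (lin τ i0 j) (lin_period τ i0 j) h12 h23 h34 h4
  rw [rowE_lin, dd_of_ne d12, dd_of_ne d23, dd_of_ne d34, dd_of_ne d41] at this
  omega

theorem val_small [NeZero L] (z l : ZMod L) (n : ℕ) (h : (z - l).val = n) :
    z = l + (n : ZMod L) := by
  rw [← h]; simp

/-- A configuration of energy at most `2L+1` with two different constant rows is in `N̂`. -/
theorem low_energy [NeZero L] (hL : 8 ≤ L) {τ : Conf L q} {j1 j2 : ZMod L} {a b : Fin q}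
    (hab : a ≠ b) (h1 : RowC τ j1 a) (h2 : RowC τ j2 b) (hH : Ham L q τ ≤ 2 * L + 1) :
    τ ∈ NHatGround L q := by
  have h2L : 2 ≤ L := by omega
  have hone := one_ne_zero_of_two_le h2L
  have cg := col_ge hab h1 h2
  have dg := diag_ge hab h1 h2
  have tH := two_Ham h2L τ
  obtain ⟨ic, hic⟩ := exists_col h2L hab h1 h2 (by omega)
  by_cases hall : ∀ j, RowK τ j
  · obtain ⟨s, m, hsm⟩ := col_pattern τ hab h1 h2 hic
    rw [G_of_rows τ (a := a) (b := b) (s := s) (m := m) fun j i c => ?_]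
    · exact G_mem h2L _ _ hab _
    · obtain ⟨d, hd⟩ := hall j
      rw [← hsm j, hd, hd]
  push Not at hall
  obtain ⟨l, hl⟩ := hall
  have rl := two_le_of_not_rowK τ hl
  have rl2 := row_le_totE τ l
  have cle : ∀ i, rowE (τ ∘ sw) i ≤ 2 := by
    intro i
    have s1 := sum_ge_one _ cg i
    have s2 := sum_ge_one _ dg 0
    have := dg 0
    unfold totE at *
    omega
  have dle : ∀ i, rowE (τ ∘ tw) i ≤ 2 := by
    intro i
    have s1 := sum_ge_one _ dg i
    have s2 := sum_ge_one _ cg 0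
    have := cg 0
    unfold totE at *
    omega
  have tle : totE τ ≤ 2 := by
    have s1 := sum_ge_one _ dg 0
    have s2 := sum_ge_one _ cg 0
    have := cg 0
    have := dg 0
    unfold totE at *
    omega
  have rest : ∀ j, j ≠ l → RowK τ j := by
    intro j hj
    have := rows_le_totE τ hj
    exact rowK_of_lt τ (by omega)
  have vals : ∀ v, τ v = a ∨ τ v = b := by
    rintro ⟨⟨i, j⟩, c⟩
    by_contra hno
    push Not at hno
    have := col_three hab h1 h2 hno.1 hno.2
    have := cle i
    omega
  obtain ⟨a', ha'⟩ := rest (l - 1) (by simpa using hone)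
  obtain ⟨b', hb'⟩ := rest (l + 1) (by simpa using hone)
  have hab' : a' ≠ b' := by
    rintro rfl
    obtain ⟨i, c, hv⟩ : ∃ i c, τ ((i, l), c) ≠ a' := by
      by_contra hno
      push Not at hno
      exact hl ⟨a', hno⟩
    obtain ⟨j3, d, hd, hda⟩ : ∃ j3 d, RowC τ j3 d ∧ d ≠ a' := by
      by_cases h : a = a'
      · exact ⟨j2, b, h2, fun h' => hab (h.trans h'.symm)⟩
      · exact ⟨j1, a, h1, h⟩
    have n0 : (j3 - (l - 1)).val ≠ 0 := by
      intro h
      have := val_small _ _ _ h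
      simp at this
      rw [this] at hd
      exact hda ((hd 0 false).symm.trans (ha' 0 false))
    have n1 : (j3 - (l - 1)).val ≠ 1 := by
      intro h
      have := val_small _ _ _ h
      simp at this
      rw [this] at hd
      exact hl ⟨d, hd⟩
    have n2 : (j3 - (l - 1)).val ≠ 2 := by
      intro h
      have := val_small _ _ _ h
      have e : l - 1 + ((2 : ℕ) : ZMod L) = l + 1 := by push_cast; ring
      rw [e] at this
      rw [this] at hd
      exact hda ((hd 0 false).symm.trans (hb' 0 false))
    have vl := ZMod.val_lt (j3 - (l - 1))
    have e0 : lin (τ ∘ sw) (l - 1) i (2 * 0) = a' := by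
      rw [lin_even]
      simp only [Function.comp, sw_apply, Nat.cast_zero, add_zero]
      exact ha' _ _
    have e2 : lin (τ ∘ sw) (l - 1) i (2 * 2) = a' := by
      rw [lin_even]
      have e : l - 1 + ((2 : ℕ) : ZMod L) = l + 1 := by push_cast; ring
      simp only [Function.comp, sw_apply, e]
      exact hb' _ _
    have e3 : lin (τ ∘ sw) (l - 1) i (2 * (j3 - (l - 1)).val) = d := by
      rw [lin_even]
      simp only [Function.comp, sw_apply, ZMod.natCast_zmod_val, add_sub_cancel]
      exact hd _ _
    have e1 : ∃ n, 2 ≤ n ∧ n ≤ 3 ∧ lin (τ ∘ sw) (l - 1) i n = τ ((i, l), c) := by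
      cases c
      · refine ⟨2 * 1, by omega, by omega, ?_⟩
        rw [lin_even]
        simp only [Function.comp, sw_apply, Nat.cast_one, sub_add_cancel]
      · refine ⟨2 * 1 + 1, by omega, by omega, ?_⟩
        rw [lin_odd]
        simp only [Function.comp, sw_apply, Nat.cast_one, sub_add_cancel]
    obtain ⟨n, hn2, hn3, e1⟩ := e1
    have := row_four (τ ∘ sw) (l - 1) i (n1 := 2 * 0) (n2 := n) (n3 := 2 * 2)
      (n4 := 2 * (j3 - (l - 1)).val) (by omega) (by omega) (by omega) (by omega)
      (by rw [e0, e1]; exact hv.symm) (by rw [e1, e2]; exact hv)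
      (by rw [e2, e3]; exact hda.symm) (by rw [e3, e0]; exact hda)
    have := cle i
    omega
  have vals' : ∀ v, τ v = a' ∨ τ v = b' := by
    have hA := vals ((0, l - 1), false)
    have hB := vals ((0, l + 1), false)
    rw [ha'] at hA
    rw [hb'] at hB
    intro v
    rcases vals v with h | h <;> rcases hA with hA | hA <;> rcases hB with hB | hB
    all_goals first
      | exact absurd (hA.trans hB.symm) hab'
      | exact Or.inl (h.trans hA.symm)
      | exact Or.inr (h.trans hB.symm)
  have F1 : ∀ i, τ ((i, l), false) = b' → τ ((i, l), true) = b' := by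
    intro i hu
    rcases vals' ((i, l), true) with hd | hd
    swap
    · exact hd
    exfalso
    have e0 : lin (τ ∘ sw) (l - 1) i (2 * 0) = a' := by
      rw [lin_even]
      simp only [Function.comp, sw_apply, Nat.cast_zero, add_zero]
      exact ha' _ _
    have e1 : lin (τ ∘ sw) (l - 1) i (2 * 1) = b' := by
      rw [lin_even]
      simp only [Function.comp, sw_apply, Nat.cast_one, sub_add_cancel]
      exact hu
    have e2 : lin (τ ∘ sw) (l - 1) i (2 * 1 + 1) = a' := by
      rw [lin_odd]
      simp only [Function.comp, sw_apply, Nat.cast_one, sub_add_cancel]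
      exact hd
    have e3 : lin (τ ∘ sw) (l - 1) i (2 * 2) = b' := by
      rw [lin_even]
      have e : l - 1 + ((2 : ℕ) : ZMod L) = l + 1 := by push_cast; ring
      simp only [Function.comp, sw_apply, e]
      exact hb' _ _
    have := row_four (τ ∘ sw) (l - 1) i (n1 := 2 * 0) (n2 := 2 * 1) (n3 := 2 * 1 + 1)
      (n4 := 2 * 2) (by omega) (by omega) (by omega) (by omega)
      (by rw [e0, e1]; exact hab') (by rw [e1, e2]; exact hab'.symm)
      (by rw [e2, e3]; exact hab') (by rw [e3, e0]; exact hab'.symm)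
    have := cle i
    omega
  have F2 : ∀ i, τ ((i, l), false) = b' → τ ((i - 1, l), true) = b' := by
    intro i hu
    rcases vals' ((i - 1, l), true) with hd | hd
    swap
    · exact hd
    exfalso
    have e0 : lin (τ ∘ tw) (i - 1) (-i - l) (2 * 0) = b' := by
      rw [lin_even]
      have e : -(i - 1) - (-i - l) = l + 1 := by ring
      simp only [Function.comp, tw_up, Nat.cast_zero, add_zero, e]
      exact hb' _ _
    have e1 : lin (τ ∘ tw) (i - 1) (-i - l) (2 * 0 + 1) = a' := by
      rw [lin_odd]
      have e : -(i - 1) - (-i - l) - 1 = l := by ring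
      simp only [Function.comp, tw_down, Nat.cast_zero, add_zero, e]
      exact hd
    have e2 : lin (τ ∘ tw) (i - 1) (-i - l) (2 * 1) = b' := by
      rw [lin_even]
      have e : -i - (-i - l) = l := by ring
      simp only [Function.comp, tw_up, Nat.cast_one, sub_add_cancel, e]
      exact hu
    have e3 : lin (τ ∘ tw) (i - 1) (-i - l) (2 * 1 + 1) = a' := by
      rw [lin_odd]
      have e : -i - (-i - l) - 1 = l - 1 := by ring
      simp only [Function.comp, tw_down, Nat.cast_one, sub_add_cancel, e]
      exact ha' _ _
    have := row_four (τ ∘ tw) (i - 1) (-i - l) (n1 := 2 * 0) (n2 := 2 * 0 + 1) (n3 := 2 * 1)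
      (n4 := 2 * 1 + 1) (by omega) (by omega) (by omega) (by omega)
      (by rw [e0, e1]; exact hab'.symm) (by rw [e1, e2]; exact hab')
      (by rw [e2, e3]; exact hab'.symm) (by rw [e3, e0]; exact hab')
    have := dle (-i - l)
    omega
  have F1' : ∀ i, τ ((i, l), true) = a' → τ ((i, l), false) = a' := by
    intro i h
    rcases vals' ((i, l), false) with h' | h'
    · exact h'
    · exact absurd (h.symm.trans (F1 i h')) hab'
  obtain ⟨i0, hi0, hi0'⟩ : ∃ i0, τ ((i0, l), false) = a' ∧ τ ((i0 - 1, l), true) = b' := by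
    by_contra hno
    push Not at hno
    have hno' : ∀ i, τ ((i, l), false) = a' → τ ((i - 1, l), true) = a' := by
      intro i hi
      rcases vals' ((i - 1, l), true) with h | h
      · exact h
      · exact absurd h (hno i hi)
    by_cases hu : ∃ i, τ ((i, l), false) = a'
    · obtain ⟨i2, hi2⟩ := hu
      have hn : ∀ n : ℕ, τ ((i2 - (n : ZMod L), l), false) = a' := by
        intro n
        induction n with
        | zero => simpa using hi2
        | succ n ih =>
          have := F1' _ (hno' _ ih)
          rw [Nat.cast_succ, ← sub_sub]
          exact this
      have hup : ∀ i, τ ((i, l), false) = a' := by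
        intro i
        have := hn (i2 - i).val
        simpa using this
      refine hl ⟨a', fun i c => ?_⟩
      cases c
      · exact hup i
      · have := hno' (i + 1) (hup _)
        simpa using this
    · push Not at hu
      have hup : ∀ i, τ ((i, l), false) = b' := fun i => (vals' _).resolve_left (hu i)
      refine hl ⟨b', fun i c => ?_⟩
      cases c
      · exact hup i
      · exact F1 i (hup i)
  have g0 : lin τ i0 l 0 = a' := by
    have := lin_even τ i0 l 0
    simp at this
    rw [this, hi0]
  have gl : lin τ i0 l (2 * L - 1) = b' := by
    rw [show 2 * L - 1 = 2 * (L - 1) + 1 by omega, lin_odd, Nat.cast_sub (by omega)]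
    simp only [CharP.cast_eq_zero, Nat.cast_one, zero_sub]
    rw [← sub_eq_add_neg]
    exact hi0'
  have hfind : ∃ n, lin τ i0 l n = b' := ⟨_, gl⟩
  set N' := Nat.find hfind with hN'
  have hN'b : lin τ i0 l N' = b' := Nat.find_spec hfind
  have hN'le : N' ≤ 2 * L - 1 := Nat.find_min' hfind gl
  have gval : ∀ n, n < 2 * L → lin τ i0 l n = if n < N' then a' else b' := by
    intro n hn
    split_ifs with h
    · exact (vals' _).resolve_right (Nat.find_min hfind h)
    · rcases vals' ((i0 + ((n / 2 : ℕ) : ZMod L), l), decide (n % 2 = 1)) with hv | hv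
      swap
      · exact hv
      exfalso
      change lin τ i0 l n = a' at hv
      have := row_four τ i0 l (n1 := 0) (n2 := N') (n3 := n) (n4 := 2 * L - 1)
        (by omega) (by omega) (by omega) (by omega)
        (by rw [g0, hN'b]; exact hab') (by rw [hN'b, hv]; exact hab'.symm)
        (by rw [hv, gl]; exact hab') (by rw [gl, g0]; exact hab'.symm)
      omega
  obtain ⟨s, m, hsm⟩ := col_pattern τ hab' ha' hb' hic
  have hA : ((l - s) - 1).val < m := by
    by_contra h
    have := hsm (l - 1)
    rw [show l - 1 - s = l - s - 1 by ring, if_neg h, ha'] at this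
    exact hab' this
  have hB : ¬ ((l - s) + 1).val < m := by
    intro h
    have := hsm (l + 1)
    rw [show l + 1 - s = l - s + 1 by ring, if_pos h, hb'] at this
    exact hab' this.symm
  have vp := val_pred (l - s)
  have vq := val_pred (l - s + 1)
  rw [add_sub_cancel_right] at vq
  have ul := ZMod.val_lt (l - s)
  have ul1 := ZMod.val_lt (l - s + 1)
  have hm : m = (l - s).val ∨ m = (l - s).val + 1 := by
    split_ifs at vp vq <;> omega
  have hG : τ = G s i0 a' b' (2 * (L * (l - s).val) + N') := by
    funext v
    obtain ⟨⟨i, j⟩, c⟩ := v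
    unfold G
    have hp := pos_lt i0 i c
    by_cases hj : j = l
    · subst hj
      rw [← lin_pos τ i0 j i c, gval _ hp]
      have : idx s i0 ((i, j), c) < 2 * (L * (j - s).val) + N' ↔ pos i0 i c < N' := by
        simp only [idx]; omega
      simp only [this]
    · obtain ⟨d, hd⟩ := rest j hj
      have hne : (j - s).val ≠ (l - s).val := fun h =>
        hj (sub_left_injective (ZMod.val_injective L h))
      rw [hd i c, ← hd ic false, hsm j]
      have : idx s i0 ((i, j), c) < 2 * (L * (l - s).val) + N' ↔ (j - s).val < m := by
        simp only [idx]
        constructor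
        · intro h
          by_contra hc
          have hlt : (l - s).val + 1 ≤ (j - s).val := by omega
          have := Nat.mul_le_mul_left L hlt
          rw [Nat.mul_succ] at this
          omega
        · intro h
          have hlt : (j - s).val + 1 ≤ (l - s).val := by omega
          have := Nat.mul_le_mul_left L hlt
          rw [Nat.mul_succ] at this
          omega
      simp only [this]
  rw [hG]
  exact G_mem h2L _ _ hab' _

theorem low_of_hasAB [NeZero L] (hL : 8 ≤ L) {τ : Conf L q} {A : Finset (Fin q)}
    (h : HasAB τ A) (hH : Ham L q τ ≤ 2 * L + 2)
    (hp : Ham L q τ ≤ 2 * L + 1 ∨ Ham L q τ % 2 ≠ cA τ A % 2) : τ ∈ NHatGround L q := by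
  obtain ⟨j1, j2, a, b, ha, hb, h1, h2⟩ := h
  have hab : a ≠ b := by rintro rfl; exact hb ha
  rcases hp with hp | hp
  · exact low_energy hL hab h1 h2 hp
  · by_cases hv : ∀ v, τ v = a ∨ τ v = b
    · exact absurd (parity (by omega) τ A ha hb hv) hp
    · push Not at hv
      obtain ⟨y, ya, yb⟩ := hv
      exact third_spin hL hab h1 h2 hH ya yb

theorem low_mem [NeZero L] (hL : 8 ≤ L) (τ : Conf L q) (A : Finset (Fin q))
    (c1 : L ^ 2 ≤ cA τ A + 1) (c2 : cA τ A ≤ L ^ 2) (hH : Ham L q τ ≤ 2 * L + 2)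
    (hp : Ham L q τ ≤ 2 * L + 1 ∨ Ham L q τ % 2 ≠ cA τ A % 2) : τ ∈ NHatGround L q := by
  have h2 : 2 ≤ L := by omega
  have hH' : (Ham L q τ + 1) ^ 2 < 6 * L ^ 2 := by
    have : (Ham L q τ + 1) ^ 2 ≤ (2 * L + 3) ^ 2 := Nat.pow_le_pow_left (by omega) 2
    nlinarith
  rcases structure_thm hL τ A hH' c1 c2 with h | h | h
  · exact low_of_hasAB hL h hH hp
  · refine NHat_comp sw (Ham_sw h2) (low_of_hasAB hL h ?_ ?_)
    · rwa [Ham_sw h2]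
    · rwa [Ham_sw h2, cA_comp]
  · refine NHat_comp tw (Ham_tw h2) (low_of_hasAB hL h ?_ ?_)
    · rwa [Ham_tw h2]
    · rwa [Ham_tw h2, cA_comp]

theorem part_one [NeZero L] (hL : 8 ≤ L) (A : Finset (Fin q)) (σ ζ : Conf L q)
    (h : NicePair L q A σ ζ) : 2 * L + 3 ≤ max (Ham L q σ) (Ham L q ζ) := by
  obtain ⟨h1, h2, _, h4, h5⟩ := h
  rw [sum_spinCount] at h4 h5
  by_contra hlt
  have hs : Ham L q σ ≤ 2 * L + 2 := by
    have := le_max_left (Ham L q σ) (Ham L q ζ); omega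
  have hz : Ham L q ζ ≤ 2 * L + 2 := by
    have := le_max_right (Ham L q σ) (Ham L q ζ); omega
  have hpos : 1 ≤ L ^ 2 := Nat.one_le_pow _ _ (by omega)
  have ns := mt (low_mem hL σ A (by omega) (by omega) hs) h1
  have nz := mt (low_mem hL ζ A (by omega) (by omega) hz) h2
  push Not at ns nz
  omega

end PartOneB

section Weights

variable {L q : ℕ}

/-- Predecessor in a row of triangles. -/
def rpred (v : ZMod L × Bool) : ZMod L × Bool :=
  if v.2 then (v.1, false) else (v.1 - 1, true)

/-- Energy of a single row. -/
noncomputable def rE [NeZero L] (r : ZMod L × Bool → Fin q) : ℕ :=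
  ∑ v, dd (r v) (r (rpred v))

theorem rE_row [NeZero L] (τ : Conf L q) (j : ZMod L) :
    rE (fun v => τ ((v.1, j), v.2)) = rowE τ j := by
  unfold rE rowE
  rw [Fintype.sum_prod_type]
  refine Finset.sum_congr rfl fun i _ => ?_
  simp [rpred]
  rw [dd_comm]

/-- Weight of a coded symbol. -/
noncomputable def gw (y : ℝ) (o : Option (Fin q)) : ℝ := o.elim 1 (fun _ => y)

/-- Code of a row. -/
noncomputable def rcode (r : ZMod L × Bool → Fin q) : Fin q × (ZMod L × Bool → Option (Fin q)) :=
  (r (0, false), fun v => if r v = r (rpred v) then none else some (r v))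

theorem rcode_inj [NeZero L] : Function.Injective (rcode : (ZMod L × Bool → Fin q) → _) := by
  intro r r' h
  have h0 : r (0, false) = r' (0, false) := congrArg Prod.fst h
  have h1 : ∀ v, (if r v = r (rpred v) then none else some (r v)) =
      (if r' v = r' (rpred v) then none else some (r' v)) := fun v =>
    congrFun (congrArg Prod.snd h) v
  have step : ∀ v, r (rpred v) = r' (rpred v) → r v = r' v := by
    intro v hv
    have := h1 v
    split_ifs at this with a b b
    · rw [a, b, hv]
    · simpa using this
  have key : ∀ n : ℕ, r ((n : ZMod L), false) = r' ((n : ZMod L), false) ∧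
      r ((n : ZMod L), true) = r' ((n : ZMod L), true) := by
    intro n
    induction n with
    | zero =>
      have := step (0, true) (by simpa [rpred] using h0)
      simpa using ⟨h0, this⟩
    | succ k ih =>
      have a := step (((k + 1 : ℕ) : ZMod L), false) (by simpa [rpred] using ih.2)
      exact ⟨a, step (((k + 1 : ℕ) : ZMod L), true) (by simpa [rpred] using a)⟩
  funext ⟨i, b⟩
  have := key i.val
  rw [ZMod.natCast_zmod_val] at this
  cases b
  · exact this.1
  · exact this.2

theorem row_sum [NeZero L] (y : ℝ) (hy : 0 ≤ y) :
    ∑ r : ZMod L × Bool → Fin q, y ^ rE r ≤ q * (1 + q * y) ^ (2 * L) := by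
  have h1 : ∀ r : ZMod L × Bool → Fin q, y ^ rE r = ∏ v, gw y ((rcode r).2 v) := by
    intro r
    unfold rE
    rw [← Finset.prod_pow_eq_pow_sum]
    refine Finset.prod_congr rfl fun v _ => ?_
    simp only [rcode]
    by_cases h : r v = r (rpred v)
    · simp [h, dd_self, gw]
    · simp [h, dd_of_ne h, gw]
  have gn : ∀ o : Option (Fin q), 0 ≤ gw y o := by
    intro o; cases o <;> simp [gw, hy]
  have h2 : ∑ r : ZMod L × Bool → Fin q, y ^ rE r ≤
      ∑ c : Fin q × (ZMod L × Bool → Option (Fin q)), ∏ v, gw y (c.2 v) := by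
    simp only [h1]
    rw [← Finset.sum_image (f := fun c : Fin q × (ZMod L × Bool → Option (Fin q)) =>
      ∏ v, gw y (c.2 v)) (s := Finset.univ) (g := rcode) (fun a _ b _ h => rcode_inj h)]
    exact Finset.sum_le_sum_of_subset_of_nonneg (Finset.subset_univ _)
      (fun c _ _ => Finset.prod_nonneg fun v _ => gn _)
  refine h2.trans (le_of_eq ?_)
  rw [Fintype.sum_prod_type]
  simp only [Finset.sum_const, Finset.card_univ, Fintype.card_fin, nsmul_eq_mul]
  congr 1
  have := Fintype.piFinset_univ (α := ZMod L × Bool) (β := fun _ => Option (Fin q))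
  rw [← this, ← Finset.prod_univ_sum (fun _ : ZMod L × Bool => (Finset.univ : Finset (Option (Fin q))))
    (fun _ o => gw y o)]
  simp only [Finset.prod_const, Fintype.sum_option, gw, Option.elim, Finset.sum_const,
    Finset.card_univ, Fintype.card_fin, nsmul_eq_mul, Fintype.card_prod, ZMod.card,
    Fintype.card_bool]
  rw [mul_comm L 2]

theorem one_add_pow_le (n : ℕ) (t : ℝ) (ht : 0 ≤ t) (h : n * t ≤ 1) : (1 + t) ^ n ≤ 3 := by
  calc (1 + t) ^ n ≤ (Real.exp t) ^ n := by
        apply pow_le_pow_left₀ (by linarith)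
        linarith [Real.add_one_le_exp t]
    _ = Real.exp (n * t) := (Real.exp_nat_mul t n).symm
    _ ≤ Real.exp 1 := Real.exp_le_exp.2 h
    _ ≤ 3 := by linarith [Real.exp_one_lt_d9]

/-- Weight of a symbol describing a row. -/
noncomputable def ww [NeZero L] (x : ℝ) (o : Option (ZMod L × Bool → Fin q)) : ℝ :=
  o.elim 1 (fun r => if 2 ≤ rE r then x ^ rE r else 0)

theorem ww_nonneg [NeZero L] {x : ℝ} (hx : 0 ≤ x) (o : Option (ZMod L × Bool → Fin q)) :
    0 ≤ ww x o := by
  cases o with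
  | none => simp [ww]
  | some r =>
    simp only [ww, Option.elim]
    split_ifs
    · positivity
    · exact le_rfl

theorem ww_sum [NeZero L] (hq : 1 ≤ q) {x : ℝ} (hx : 0 ≤ x) (hx1 : 12 * q ^ 3 * L ^ 3 * x ^ 2 ≤ 1) :
    (∑ o : Option (ZMod L × Bool → Fin q), ww x o) ^ L ≤ 3 := by
  have hL : (1 : ℝ) ≤ L := by exact_mod_cast Nat.one_le_iff_ne_zero.2 (NeZero.ne L)
  have hq' : (1 : ℝ) ≤ q := by exact_mod_cast hq
  set y : ℝ := 1 / (2 * L * q) with hy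
  have hy0 : 0 < y := by positivity
  have hxy : x ≤ y := by
    refine le_of_sq_le_sq ?_ hy0.le
    rw [hy, div_pow, le_div_iff₀ (by positivity)]
    have : (2 * L * q : ℝ) ^ 2 ≤ 12 * q ^ 3 * L ^ 3 := by
      have a : (q : ℝ) ^ 2 ≤ q ^ 3 := pow_le_pow_right₀ hq' (by norm_num)
      have b : (L : ℝ) ^ 2 ≤ L ^ 3 := pow_le_pow_right₀ hL (by norm_num)
      have : (q : ℝ) ^ 2 * L ^ 2 ≤ q ^ 3 * L ^ 3 := by gcongr
      nlinarith [show (0 : ℝ) ≤ q ^ 2 * L ^ 2 by positivity]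
    nlinarith [mul_le_mul_of_nonneg_right this (sq_nonneg x)]
  have h1 : ∀ r : ZMod L × Bool → Fin q, ww x (some r) ≤ x ^ 2 / y ^ 2 * y ^ rE r := by
    intro r
    simp only [ww, Option.elim]
    split_ifs with h
    · obtain ⟨k, hk⟩ := Nat.exists_eq_add_of_le h
      rw [hk, pow_add, pow_add]
      have : x ^ k ≤ y ^ k := pow_le_pow_left₀ hx hxy k
      calc x ^ 2 * x ^ k ≤ x ^ 2 * y ^ k := by gcongr
        _ = x ^ 2 / y ^ 2 * (y ^ 2 * y ^ k) := by field_simp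
    · positivity
  have h2 : ∑ r : ZMod L × Bool → Fin q, ww x (some r) ≤ x ^ 2 / y ^ 2 * (q * 3) := by
    calc _ ≤ ∑ r : ZMod L × Bool → Fin q, x ^ 2 / y ^ 2 * y ^ rE r :=
          Finset.sum_le_sum fun r _ => h1 r
      _ = x ^ 2 / y ^ 2 * ∑ r : ZMod L × Bool → Fin q, y ^ rE r := by rw [Finset.mul_sum]
      _ ≤ x ^ 2 / y ^ 2 * (q * (1 + q * y) ^ (2 * L)) := by
          gcongr
          exact row_sum y hy0.le
      _ ≤ _ := by
          gcongr
          refine one_add_pow_le _ _ (by positivity) (le_of_eq ?_)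
          rw [hy]; push_cast; field_simp
  rw [Fintype.sum_option]
  have h3 : ww x (none : Option (ZMod L × Bool → Fin q)) = 1 := rfl
  rw [h3]
  refine one_add_pow_le _ _ (Finset.sum_nonneg fun r _ => ww_nonneg hx _) ?_
  have h4 : x ^ 2 / y ^ 2 * (q * 3) = 12 * q ^ 3 * L ^ 2 * x ^ 2 := by
    rw [hy]; field_simp; ring
  rw [h4] at h2
  calc _ ≤ (L : ℝ) * (12 * q ^ 3 * L ^ 2 * x ^ 2) := by gcongr
    _ = 12 * q ^ 3 * L ^ 3 * x ^ 2 := by ring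
    _ ≤ 1 := hx1

/-- The description of a configuration by its non-constant rows. -/
noncomputable def Dmap (τ : Conf L q) (j : ZMod L) : Option (ZMod L × Bool → Fin q) :=
  if RowK τ j then none else some (fun v => τ ((v.1, j), v.2))

theorem ww_Dmap [NeZero L] (x : ℝ) (τ : Conf L q) : ∏ j, ww x (Dmap τ j) = x ^ totE τ := by
  unfold totE
  rw [← Finset.prod_pow_eq_pow_sum]
  refine Finset.prod_congr rfl fun j _ => ?_
  unfold Dmap
  split_ifs with h
  · rw [rowE_zero_of_rowK τ h]; simp [ww]
  · simp only [ww, Option.elim]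
    rw [rE_row, if_pos (two_le_of_not_rowK τ h)]

/-- All constant rows follow an interval pattern. -/
def Pat (a b : Fin q) (s : ZMod L) (τ : Conf L q) (m : ℕ) : Prop :=
  ∀ j, RowK τ j → RowC τ j (if (j - s).val < m then a else b)

theorem Dmap_inj_aux [NeZero L] (A : Finset (Fin q)) {a b : Fin q} (ha : a ∈ A) (hb : b ∉ A)
    {s : ZMod L} {τ τ' : Conf L q} {m m' : ℕ} (h : Pat a b s τ m) (h' : Pat a b s τ' m')
    (hm : m ≤ m') (hc : cA τ A = cA τ' A) (hD : Dmap τ = Dmap τ') : τ = τ' := by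
  have hK : ∀ j, RowK τ j ↔ RowK τ' j := by
    intro j
    have := congrFun hD j
    unfold Dmap at this
    split_ifs at this with h1 h2 h2 <;> simp_all
  have hN : ∀ j, ¬ RowK τ j → ∀ i b, τ ((i, j), b) = τ' ((i, j), b) := by
    intro j hj i b
    have := congrFun hD j
    unfold Dmap at this
    rw [if_neg hj, if_neg (fun h => hj ((hK j).2 h))] at this
    exact congrFun (Option.some.inj this) (i, b)
  have sub : (Finset.univ.filter fun v => τ v ∈ A) ⊆ (Finset.univ.filter fun v => τ' v ∈ A) := by
    rintro ⟨⟨i, j⟩, c⟩ hv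
    simp only [Finset.mem_filter, Finset.mem_univ, true_and] at hv ⊢
    by_cases hj : RowK τ j
    · have e1 := h j hj i c
      have e2 := h' j ((hK j).1 hj) i c
      rw [e2]
      rw [e1] at hv
      split_ifs at hv with h1
      · rw [if_pos (by omega)]; exact ha
      · exact absurd hv hb
    · rw [← hN j hj]; exact hv
  have eqf := Finset.eq_of_subset_of_card_le sub (le_of_eq hc.symm)
  funext ⟨⟨i, j⟩, c⟩
  by_cases hj : RowK τ j
  · have e1 := h j hj i c
    have e2 := h' j ((hK j).1 hj) i c
    have e3 : τ ((i, j), c) ∈ A ↔ τ' ((i, j), c) ∈ A := by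
      have := Finset.ext_iff.1 eqf ((i, j), c)
      simpa using this
    rw [e1, e2] at e3 ⊢
    split_ifs at e3 ⊢ <;> simp_all
  · exact hN j hj i c

theorem class_card [NeZero L] (hq : 1 ≤ q) (A : Finset (Fin q)) {a b : Fin q} (ha : a ∈ A)
    (hb : b ∉ A) (s : ZMod L) (c n : ℕ) {x : ℝ} (hx : 0 < x)
    (hx1 : 12 * q ^ 3 * L ^ 3 * x ^ 2 ≤ 1) (hx2 : x ≤ 1) :
    ((Finset.univ.filter fun τ : Conf L q =>
      (∃ m, Pat a b s τ m) ∧ cA τ A = c ∧ totE τ ≤ n).card : ℝ) * x ^ n ≤ 3 := by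
  set T := Finset.univ.filter fun τ : Conf L q =>
      (∃ m, Pat a b s τ m) ∧ cA τ A = c ∧ totE τ ≤ n with hT
  have inj : Set.InjOn (Dmap : Conf L q → _) T := by
    intro τ h τ' h' hD
    simp only [hT, Finset.coe_filter, Finset.mem_univ, true_and, Set.mem_ofPred_eq] at h h'
    obtain ⟨⟨m, hm⟩, hc, -⟩ := h
    obtain ⟨⟨m', hm'⟩, hc', -⟩ := h'
    rcases le_total m m' with h | h
    · exact Dmap_inj_aux A ha hb hm hm' h (hc.trans hc'.symm) hD
    · exact (Dmap_inj_aux A ha hb hm' hm h (hc'.trans hc.symm) hD.symm).symm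
  have h1 : (T.card : ℝ) * x ^ n ≤ ∑ τ ∈ T, ∏ j, ww x (Dmap τ j) := by
    rw [← nsmul_eq_mul]
    refine Finset.card_nsmul_le_sum _ _ _ fun τ h => ?_
    rw [ww_Dmap]
    simp only [hT, Finset.mem_filter] at h
    exact pow_le_pow_of_le_one hx.le hx2 h.2.2.2
  refine h1.trans ?_
  rw [← Finset.sum_image (f := fun D : ZMod L → Option (ZMod L × Bool → Fin q) =>
      ∏ j, ww x (D j)) inj]
  refine (Finset.sum_le_sum_of_subset_of_nonneg (Finset.subset_univ _)
      (fun c _ _ => Finset.prod_nonneg fun v _ => ww_nonneg hx.le _)).trans ?_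
  rw [← Fintype.piFinset_univ, ← Finset.prod_univ_sum
    (fun _ : ZMod L => (Finset.univ : Finset (Option (ZMod L × Bool → Fin q))))
    (fun _ o => ww x o)]
  rw [Finset.prod_const, Finset.card_univ, ZMod.card]
  exact ww_sum hq hx.le hx1

end Weights

section Pairs

variable {L q : ℕ}

/-- Configurations of low energy with bridges of both kinds in the first direction. -/
noncomputable def MM [NeZero L] (A : Finset (Fin q)) (c i : ℕ) : Finset (Conf L q) :=
  Finset.univ.filter fun τ => HasAB τ A ∧ Ham L q τ ≤ 2 * L + i ∧ 2 * Ham L q τ < 5 * L ∧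
    cA τ A = c

theorem mem_MM [NeZero L] {A : Finset (Fin q)} {c i : ℕ} {τ : Conf L q} :
    τ ∈ MM A c i ↔ HasAB τ A ∧ Ham L q τ ≤ 2 * L + i ∧ 2 * Ham L q τ < 5 * L ∧ cA τ A = c := by
  simp [MM]

theorem MM_totE [NeZero L] (hL : 2 ≤ L) {A : Finset (Fin q)} {c i : ℕ} {τ : Conf L q}
    (h : τ ∈ MM A c i) : totE τ ≤ 2 * i := by
  obtain ⟨⟨j1, j2, a, b, ha, hb, h1, h2⟩, hH, -, -⟩ := mem_MM.1 h
  have hab : a ≠ b := by rintro rfl; exact hb ha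
  have := totE_le hL hab h1 h2
  omega

theorem MM_pat [NeZero L] (hL : 2 ≤ L) {A : Finset (Fin q)} {c i : ℕ} {τ : Conf L q}
    (h : τ ∈ MM A c i) : ∃ a ∈ A, ∃ b, b ∉ A ∧ ∃ s m, Pat a b s τ m := by
  obtain ⟨⟨j1, j2, a, b, ha, hb, h1, h2⟩, -, hH, -⟩ := mem_MM.1 h
  have hab : a ≠ b := by rintro rfl; exact hb ha
  obtain ⟨k, hk⟩ := exists_col hL hab h1 h2 hH
  obtain ⟨s, m, hs⟩ := col_pattern τ hab h1 h2 hk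
  refine ⟨a, ha, b, hb, s, m, ?_⟩
  rintro j ⟨d, hd⟩
  rw [← hs j, hd k false]
  exact hd

theorem MM_card [NeZero L] (hL : 2 ≤ L) (hq : 1 ≤ q) (A : Finset (Fin q)) (c i : ℕ) {K : ℝ}
    (hK : 12 * q ^ 3 * L ^ 3 ≤ K) :
    ((MM A c i : Finset (Conf L q)).card : ℝ) ≤ 3 * q ^ 2 * L * K ^ i := by
  have hL1 : (1 : ℝ) ≤ L := by exact_mod_cast (by omega : 1 ≤ L)
  have hq' : (1 : ℝ) ≤ q := by exact_mod_cast hq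
  have hK1 : 1 ≤ K := by
    have : (1 : ℝ) ≤ q ^ 3 * L ^ 3 := one_le_mul_of_one_le_of_one_le (one_le_pow₀ hq') (one_le_pow₀ hL1)
    linarith
  set x : ℝ := Real.sqrt (1 / K) with hx
  have hx2 : x ^ 2 = 1 / K := Real.sq_sqrt (by positivity)
  have hx0 : 0 < x := Real.sqrt_pos.2 (by positivity)
  have hx1 : x ≤ 1 := by
    rw [hx, Real.sqrt_le_iff]
    refine ⟨zero_le_one, ?_⟩
    rw [one_pow, div_le_one (by linarith)]; exact hK1
  have hx3 : 12 * (q : ℝ) ^ 3 * L ^ 3 * x ^ 2 ≤ 1 := by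
    rw [hx2, mul_one_div, div_le_one (by linarith)]; exact hK
  set F : Fin q × Fin q × ZMod L → Finset (Conf L q) := fun p =>
    if p.1 ∈ A ∧ p.2.1 ∉ A then Finset.univ.filter fun τ : Conf L q =>
      (∃ m, Pat p.1 p.2.1 p.2.2 τ m) ∧ cA τ A = c ∧ totE τ ≤ 2 * i else ∅ with hF
  have sub : MM A c i ⊆ Finset.univ.biUnion F := by
    intro τ h
    obtain ⟨a, ha, b, hb, s, hs⟩ := MM_pat hL h
    simp only [Finset.mem_biUnion, Finset.mem_univ, true_and]
    refine ⟨(a, b, s), ?_⟩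
    simp only [hF]
    rw [if_pos ⟨ha, hb⟩]
    simp only [Finset.mem_filter, Finset.mem_univ, true_and]
    exact ⟨hs, (mem_MM.1 h).2.2.2, MM_totE hL h⟩
  have hFc : ∀ p, ((F p).card : ℝ) ≤ 3 * K ^ i := by
    rintro ⟨a, b, s⟩
    simp only [hF]
    split_ifs with h
    · have := class_card hq A h.1 h.2 s c (2 * i) hx0 hx3 hx1
      rw [pow_mul, hx2, div_pow, one_pow, mul_one_div, div_le_iff₀ (by positivity)] at this
      exact this
    · simp; positivity
  calc ((MM A c i : Finset (Conf L q)).card : ℝ) ≤ ((Finset.univ.biUnion F).card : ℝ) := by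
        exact_mod_cast Finset.card_le_card sub
    _ ≤ ∑ p, ((F p).card : ℝ) := by exact_mod_cast Finset.card_biUnion_le
    _ ≤ ∑ p : Fin q × Fin q × ZMod L, 3 * K ^ i := Finset.sum_le_sum fun p _ => hFc p
    _ = 3 * q ^ 2 * L * K ^ i := by
        simp [Finset.card_univ, ZMod.card]; ring

/-- Energy of a parallel class of edges. -/
noncomputable def Es [NeZero L] (π : ZMod L × ZMod L ≃ ZMod L × ZMod L) (τ : Conf L q) : ℕ :=
  ∑ p, dd (τ (p, false)) (τ (π p, true))

/-- Sites incident to a broken edge of a parallel class. -/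
noncomputable def wall [NeZero L] (π : ZMod L × ZMod L ≃ ZMod L × ZMod L) (τ : Conf L q) :
    Finset (Site L) :=
  ((Finset.univ.filter fun p => τ (p, false) ≠ τ (π p, true)).image fun p => (p, false)) ∪
  ((Finset.univ.filter fun p => τ (p, false) ≠ τ (π p, true)).image fun p => (π p, true))

theorem wall_card [NeZero L] (π : ZMod L × ZMod L ≃ ZMod L × ZMod L) (τ : Conf L q) :
    (wall π τ).card ≤ 2 * Es π τ := by
  have h : (Finset.univ.filter fun p => τ (p, false) ≠ τ (π p, true)).card = Es π τ := by
    rw [Finset.card_filter]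
    refine Finset.sum_congr rfl fun p _ => ?_
    by_cases h : τ (p, false) = τ (π p, true)
    · simp [h, dd_self]
    · simp [h, dd_of_ne h]
  refine (Finset.card_union_le _ _).trans ?_
  have a := Finset.card_image_le (s := Finset.univ.filter fun p => τ (p, false) ≠ τ (π p, true))
    (f := fun p => ((p, false) : Site L))
  have b := Finset.card_image_le (s := Finset.univ.filter fun p => τ (p, false) ≠ τ (π p, true))
    (f := fun p => ((π p, true) : Site L))
  omega

theorem edge_pt [NeZero L] (π : ZMod L × ZMod L ≃ ZMod L × ZMod L) (x : Site L) :
    ∃ p0, (x = (p0, false) ∨ x = (π p0, true)) ∧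
      ∀ p, p ≠ p0 → (p, false) ≠ x ∧ (π p, true) ≠ x := by
  obtain ⟨p, c⟩ := x
  cases c
  · refine ⟨p, Or.inl rfl, fun r hr => ⟨?_, ?_⟩⟩
    · simpa using hr
    · simp
  · refine ⟨π.symm p, Or.inr (by simp), fun r hr => ⟨by simp, ?_⟩⟩
    simp only [ne_eq, Prod.mk.injEq, and_true]
    intro h
    exact hr (by rw [← h]; simp)

theorem Es_le [NeZero L] (π : ZMod L × ZMod L ≃ ZMod L × ZMod L) {σ ζ : Conf L q} {x : Site L}
    (h : ∀ y, y ≠ x → σ y = ζ y) : Es π σ ≤ Es π ζ + 1 := by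
  obtain ⟨p0, -, hp⟩ := edge_pt π x
  have : Es π σ ≤ ∑ p, (dd (ζ (p, false)) (ζ (π p, true)) + if p = p0 then 1 else 0) := by
    refine Finset.sum_le_sum fun p _ => ?_
    by_cases e : p = p0
    · rw [if_pos e]
      have := dd_le_one (σ (p, false)) (σ (π p, true))
      omega
    · rw [h _ (hp p e).1, h _ (hp p e).2]; omega
  rw [Finset.sum_add_distrib] at this
  simpa [Es] using this

theorem Es_lt [NeZero L] (π : ZMod L × ZMod L ≃ ZMod L × ZMod L) {σ ζ : Conf L q} {x : Site L}
    (h : ∀ y, y ≠ x → σ y = ζ y) (hx : σ x ≠ ζ x) (hw : x ∉ wall π σ) :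
    Es π σ + 1 ≤ Es π ζ := by
  obtain ⟨p0, h0, hp⟩ := edge_pt π x
  have e0 : σ (p0, false) = σ (π p0, true) := by
    by_contra hne
    apply hw
    unfold wall
    rw [Finset.mem_union, Finset.mem_image, Finset.mem_image]
    rcases h0 with h0 | h0
    · exact Or.inl ⟨p0, by simpa using hne, h0.symm⟩
    · exact Or.inr ⟨p0, by simpa using hne, h0.symm⟩
  have e1 : ζ (p0, false) ≠ ζ (π p0, true) := by
    rcases h0 with h0 | h0
    · subst h0
      rw [← h (π p0, true) (by simp), ← e0]
      exact fun h => hx h.symm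
    · subst h0
      rw [← h (p0, false) (by simp), e0]
      exact hx
  change Es π σ < Es π ζ
  unfold Es
  refine Finset.sum_lt_sum (fun p _ => ?_) ⟨p0, Finset.mem_univ _, ?_⟩
  · by_cases e : p = p0
    · rw [e, e0, dd_self]; exact Nat.zero_le _
    · rw [h _ (hp p e).1, h _ (hp p e).2]
  · rw [e0, dd_self, dd_of_ne e1]; exact Nat.one_pos

/-- Translation of the torus. -/
def tr (a b : ZMod L) : ZMod L × ZMod L ≃ ZMod L × ZMod L where
  toFun p := (p.1 - a, p.2 - b)
  invFun p := (p.1 + a, p.2 + b)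
  left_inv p := by simp
  right_inv p := by simp

theorem E0_Es [NeZero L] (τ : Conf L q) : E0 τ = Es (Equiv.refl _) τ := rfl
theorem E1_Es [NeZero L] (τ : Conf L q) : E1 τ = Es (tr 1 0) τ := by
  simp [E1, Es, tr]
theorem E2_Es [NeZero L] (τ : Conf L q) : E2 τ = Es (tr 0 1) τ := by
  simp [E2, Es, tr]

/-- Sites in the first direction next to a broken edge. -/
noncomputable def walls [NeZero L] (τ : Conf L q) : Finset (Site L) :=
  wall (Equiv.refl _) τ ∪ wall (tr 1 0) τ

theorem walls_card [NeZero L] (τ : Conf L q) : (walls τ).card ≤ 2 * totE τ := by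
  refine (Finset.card_union_le _ _).trans ?_
  have a := wall_card (Equiv.refl _) τ
  have b := wall_card (tr 1 0) τ
  rw [totE_eq, E0_Es, E1_Es]
  omega

theorem mem_walls [NeZero L] (hL : 2 ≤ L) {σ ζ : Conf L q} {x : Site L}
    (h : ∀ y, y ≠ x → σ y = ζ y) (hx : σ x ≠ ζ x) (hH : Ham L q ζ ≤ Ham L q σ) : x ∈ walls σ := by
  by_contra hw
  unfold walls at hw
  rw [Finset.mem_union, not_or] at hw
  have a := Es_lt _ h hx hw.1
  have b := Es_lt _ h hx hw.2
  have c := Es_le (tr 0 1) h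
  rw [Ham_eq hL, Ham_eq hL, E0_Es, E0_Es, E1_Es, E1_Es, E2_Es, E2_Es] at hH
  omega

theorem eq_update {σ ζ : Conf L q} {x : Site L} (h : ∀ y, y ≠ x → σ y = ζ y) :
    ζ = Function.update σ x (ζ x) := by
  funext y
  by_cases e : y = x
  · subst e; simp
  · rw [Function.update_of_ne e, h y e]

/-- Pairs obtained from `M` by a flip at an allowed site. -/
noncomputable def prs [NeZero L] (M : Finset (Conf L q)) (w : Conf L q → Finset (Site L)) :
    Finset (Conf L q × Conf L q) :=
  M.biUnion fun σ => (w σ ×ˢ (Finset.univ : Finset (Fin q))).image fun p =>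
    (σ, Function.update σ p.1 p.2)

theorem prs_card [NeZero L] (M : Finset (Conf L q)) (w : Conf L q → Finset (Site L)) (n : ℕ)
    (h : ∀ σ ∈ M, (w σ).card ≤ n) : (prs M w).card ≤ M.card * (n * q) := by
  refine Finset.card_biUnion_le_card_mul _ _ _ fun σ hσ => Finset.card_image_le.trans ?_
  rw [Finset.card_product, Finset.card_univ, Fintype.card_fin]
  exact Nat.mul_le_mul_right _ (h σ hσ)

theorem mem_prs [NeZero L] {M : Finset (Conf L q)} {w : Conf L q → Finset (Site L)}
    {σ ζ : Conf L q} {x : Site L} (hσ : σ ∈ M) (hx : x ∈ w σ) (h : ∀ y, y ≠ x → σ y = ζ y) :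
    (σ, ζ) ∈ prs M w := by
  unfold prs
  rw [Finset.mem_biUnion]
  refine ⟨σ, hσ, Finset.mem_image.2 ⟨(x, ζ x), by simpa using hx, ?_⟩⟩
  simp only
  rw [← eq_update h]

/-- Candidates for nice pairs, in the first direction. -/
noncomputable def XX [NeZero L] (A : Finset (Fin q)) (i : ℕ) : Finset (Conf L q × Conf L q) :=
  prs (MM A (L ^ 2) (i - 1)) (fun _ => Finset.univ) ∪
  ((prs (MM A (L ^ 2 - 1) (i - 1)) (fun _ => Finset.univ)).image Prod.swap ∪
  prs (MM A (L ^ 2) i) walls)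

theorem XX_card [NeZero L] (hL : 2 ≤ L) (hq : 1 ≤ q) (A : Finset (Fin q)) (i : ℕ) (hi : 1 ≤ i)
    {K : ℝ} (hK : 12 * q ^ 3 * L ^ 3 ≤ K) :
    ((XX A i : Finset (Conf L q × Conf L q)).card : ℝ) ≤ 12 * q ^ 3 * L * K ^ i * (i + 1) := by
  have hL1 : (1 : ℝ) ≤ L := by exact_mod_cast (by omega : 1 ≤ L)
  have hq' : (1 : ℝ) ≤ q := by exact_mod_cast hq
  have hK1 : (L : ℝ) ^ 2 ≤ K := by
    have : (1 : ℝ) ≤ q ^ 3 := one_le_pow₀ hq'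
    have b : (L : ℝ) ^ 2 ≤ L ^ 3 := pow_le_pow_right₀ hL1 (by norm_num)
    nlinarith [show (0 : ℝ) ≤ L ^ 3 by positivity]
  have c1 : ∀ c, ((prs (MM A c (i - 1)) (fun _ => Finset.univ) :
      Finset (Conf L q × Conf L q)).card : ℝ) ≤ 3 * q ^ 2 * L * K ^ (i - 1) * (2 * L ^ 2 * q) := by
    intro c
    have a := prs_card (MM A c (i - 1) : Finset (Conf L q)) (fun _ => Finset.univ) (2 * L ^ 2)
      (fun σ _ => by rw [Finset.card_univ, card_site])
    have b := MM_card hL hq A c (i - 1) hK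
    calc _ ≤ (((MM A c (i - 1) : Finset (Conf L q)).card * (2 * L ^ 2 * q) : ℕ) : ℝ) := by
          exact_mod_cast a
      _ = ((MM A c (i - 1) : Finset (Conf L q)).card : ℝ) * (2 * L ^ 2 * q) := by push_cast; ring
      _ ≤ _ := by gcongr
  have c2 : ((prs (MM A (L ^ 2) i) walls : Finset (Conf L q × Conf L q)).card : ℝ) ≤
      3 * q ^ 2 * L * K ^ i * (4 * i * q) := by
    have a := prs_card (MM A (L ^ 2) i : Finset (Conf L q)) walls (4 * i)
      (fun σ h => by
        have := walls_card σ
        have := MM_totE hL h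
        omega)
    have b := MM_card hL hq A (L ^ 2) i hK
    calc _ ≤ (((MM A (L ^ 2) i : Finset (Conf L q)).card * (4 * i * q) : ℕ) : ℝ) := by
          exact_mod_cast a
      _ = ((MM A (L ^ 2) i : Finset (Conf L q)).card : ℝ) * (4 * i * q) := by push_cast; ring
      _ ≤ _ := by gcongr
  have c3 : (XX A i : Finset (Conf L q × Conf L q)).card ≤
      (prs (MM A (L ^ 2) (i - 1)) (fun _ => Finset.univ) : Finset (Conf L q × Conf L q)).card +
      ((prs (MM A (L ^ 2 - 1) (i - 1)) (fun _ => Finset.univ) : Finset (Conf L q × Conf L q)).card +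
      (prs (MM A (L ^ 2) i) walls : Finset (Conf L q × Conf L q)).card) := by
    refine (Finset.card_union_le _ _).trans (Nat.add_le_add_left ?_ _)
    refine (Finset.card_union_le _ _).trans (Nat.add_le_add_right ?_ _)
    exact Finset.card_image_le
  have c4 : ((XX A i : Finset (Conf L q × Conf L q)).card : ℝ) ≤
      3 * q ^ 2 * L * K ^ (i - 1) * (2 * L ^ 2 * q) +
      (3 * q ^ 2 * L * K ^ (i - 1) * (2 * L ^ 2 * q) + 3 * q ^ 2 * L * K ^ i * (4 * i * q)) := by
    have : ((XX A i : Finset (Conf L q × Conf L q)).card : ℝ) ≤ _ := Nat.cast_le.2 c3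
    push_cast at this
    linarith [c1 (L ^ 2), c1 (L ^ 2 - 1)]
  have c5 : K ^ (i - 1) * (L : ℝ) ^ 2 ≤ K ^ i := by
    obtain ⟨k, rfl⟩ := Nat.exists_eq_add_of_le' hi
    rw [Nat.add_sub_cancel, pow_succ K k]
    have : 0 ≤ K := le_trans (by positivity) hK1
    gcongr
  calc _ ≤ _ := c4
    _ = 12 * q ^ 3 * L * (K ^ (i - 1) * (L : ℝ) ^ 2) + 12 * q ^ 3 * L * K ^ i * i := by ring
    _ ≤ 12 * q ^ 3 * L * K ^ i + 12 * q ^ 3 * L * K ^ i * i := by gcongr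
    _ = _ := by ring

/-- Precomposition of a pair with a symmetry. -/
def cmp (e : Site L ≃ Site L) (p : Conf L q × Conf L q) : Conf L q × Conf L q :=
  (p.1 ∘ e, p.2 ∘ e)

theorem cmp_inj (e : Site L ≃ Site L) : Function.Injective (cmp e : Conf L q × Conf L q → _) := by
  rintro ⟨a, b⟩ ⟨c, d⟩ h
  simp only [cmp, Prod.mk.injEq] at h
  have h1 := e.surjective.injective_comp_right h.1
  have h2 := e.surjective.injective_comp_right h.2
  rw [h1, h2]

theorem pair_mem [NeZero L] (hL : 8 ≤ L) (A : Finset (Fin q)) (i : ℕ) (hi : (2 * L + i + 1) ^ 2 < 6 * L ^ 2)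
    {σ ζ : Conf L q} (hf : oneFlip σ ζ) (h1 : cA σ A = L ^ 2) (h2 : cA ζ A = L ^ 2 - 1)
    (hm : max (Ham L q σ) (Ham L q ζ) = 2 * L + i) :
    ∃ e : Site L ≃ Site L, (e = Equiv.refl _ ∨ e = sw ∨ e = tw) ∧ cmp e (σ, ζ) ∈ XX A i := by
  have hL2 : 1 ≤ L ^ 2 := Nat.one_le_pow _ _ (by omega)
  have hs : Ham L q σ ≤ 2 * L + i := hm ▸ le_max_left _ _
  have hz : Ham L q ζ ≤ 2 * L + i := hm ▸ le_max_right _ _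
  have hi5 : 2 * (2 * L + i) < 5 * L := by
    by_contra hc
    push Not at hc
    nlinarith
  have low : ∀ τ : Conf L q, Ham L q τ ≤ 2 * L + i → L ^ 2 ≤ cA τ A + 1 → cA τ A ≤ L ^ 2 →
      ∃ e : Site L ≃ Site L, (e = Equiv.refl _ ∨ e = sw ∨ e = tw) ∧ HasAB (τ ∘ e) A := by
    intro τ h a b
    have : (Ham L q τ + 1) ^ 2 < 6 * L ^ 2 :=
      lt_of_le_of_lt (Nat.pow_le_pow_left (by omega) 2) hi
    rcases structure_thm hL τ A this a b with h | h | h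
    · exact ⟨Equiv.refl _, Or.inl rfl, h⟩
    · exact ⟨sw, Or.inr (Or.inl rfl), h⟩
    · exact ⟨tw, Or.inr (Or.inr rfl), h⟩
  have inv : ∀ e : Site L ≃ Site L, (e = Equiv.refl _ ∨ e = sw ∨ e = tw) → ∀ τ : Conf L q,
      Ham L q (τ ∘ e) = Ham L q τ := by
    rintro e (rfl | rfl | rfl) τ
    · rfl
    · exact Ham_sw (by omega) τ
    · exact Ham_tw (by omega) τ
  by_cases hlt : Ham L q ζ < Ham L q σ
  · obtain ⟨e, he, hab⟩ := low ζ hz (by omega) (by omega)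
    refine ⟨e, he, ?_⟩
    obtain ⟨x, hx, hxy⟩ := oneFlip_symm (oneFlip_comp e hf)
    refine Finset.mem_union_right _ (Finset.mem_union_left _
      (Finset.mem_image.2 ⟨(ζ ∘ e, σ ∘ e), ?_, rfl⟩))
    refine mem_prs (mem_MM.2 ⟨hab, ?_, ?_, ?_⟩) (Finset.mem_univ x) hxy
    · rw [inv e he]; omega
    · rw [inv e he]; omega
    · rw [cA_comp, h2]
  · obtain ⟨e, he, hab⟩ := low σ hs (by omega) (by omega)
    refine ⟨e, he, ?_⟩
    obtain ⟨x, hx, hxy⟩ := oneFlip_comp e hf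
    by_cases hlt' : Ham L q σ < Ham L q ζ
    · refine Finset.mem_union_left _
        (mem_prs (mem_MM.2 ⟨hab, ?_, ?_, ?_⟩) (Finset.mem_univ x) hxy)
      · have := inv e he σ; dsimp only; omega
      · have := inv e he σ; dsimp only; omega
      · rw [cA_comp, h1]
    · refine Finset.mem_union_right _ (Finset.mem_union_right _
        (mem_prs (mem_MM.2 ⟨hab, ?_, ?_, ?_⟩) (mem_walls (by omega) hxy hx ?_) hxy))
      · have := inv e he σ; dsimp only; omega
      · have := inv e he σ; dsimp only; omega
      · rw [cA_comp, h1]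
      · have := inv e he σ; have := inv e he ζ; dsimp only; omega

theorem part_two [NeZero L] (hL : 8 ≤ L) (hq : 1 ≤ q) (A : Finset (Fin q)) (i : ℕ) (hi0 : 1 ≤ i)
    (hi : (2 * L + i + 1) ^ 2 < 6 * L ^ 2) {K : ℝ} (hK : 12 * q ^ 3 * L ^ 3 ≤ K) :
    (Nat.card {p : Conf L q × Conf L q //
      NicePair L q A p.1 p.2 ∧ max (Ham L q p.1) (Ham L q p.2) = 2 * L + i} : ℝ) ≤
      36 * q ^ 3 * L * K ^ i * (i + 1) := by
  set N := Finset.univ.filter fun p : Conf L q × Conf L q =>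
      NicePair L q A p.1 p.2 ∧ max (Ham L q p.1) (Ham L q p.2) = 2 * L + i with hN
  have hc : Nat.card {p : Conf L q × Conf L q //
      NicePair L q A p.1 p.2 ∧ max (Ham L q p.1) (Ham L q p.2) = 2 * L + i} = N.card := by
    rw [Nat.card_eq_fintype_card, Fintype.card_subtype]
  have pre : ∀ e : Site L ≃ Site L, (N.filter fun p => cmp e p ∈ XX A i).card ≤
      (XX A i : Finset (Conf L q × Conf L q)).card := by
    intro e
    refine Finset.card_le_card_of_injOn (cmp e) ?_ (cmp_inj e).injOn
    intro p hp
    exact (Finset.mem_filter.1 hp).2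
  have sub : N ⊆ (N.filter fun p => cmp (Equiv.refl _) p ∈ XX A i) ∪
      ((N.filter fun p => cmp sw p ∈ XX A i) ∪ (N.filter fun p => cmp tw p ∈ XX A i)) := by
    rintro ⟨σ, ζ⟩ hp
    have hp' := (Finset.mem_filter.1 hp).2
    obtain ⟨⟨-, -, hf, h1, h2⟩, hm⟩ := hp'
    rw [sum_spinCount] at h1 h2
    obtain ⟨e, he, hX⟩ := pair_mem hL A i hi hf h1 h2 hm
    simp only [Finset.mem_union, Finset.mem_filter]
    rcases he with rfl | rfl | rfl
    · exact Or.inl ⟨hp, hX⟩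
    · exact Or.inr (Or.inl ⟨hp, hX⟩)
    · exact Or.inr (Or.inr ⟨hp, hX⟩)
  have hcard : N.card ≤ 3 * (XX A i : Finset (Conf L q × Conf L q)).card := by
    have a := Finset.card_le_card sub
    have b := Finset.card_union_le (N.filter fun p => cmp (Equiv.refl _) p ∈ XX A i)
      ((N.filter fun p => cmp sw p ∈ XX A i) ∪ (N.filter fun p => cmp tw p ∈ XX A i))
    have c := Finset.card_union_le (N.filter fun p => cmp sw p ∈ XX A i)
      (N.filter fun p => cmp tw p ∈ XX A i)
    have := pre (Equiv.refl _)
    have := pre sw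
    have := pre tw
    omega
  rw [hc]
  have h1 : (N.card : ℝ) ≤ 3 * ((XX A i : Finset (Conf L q × Conf L q)).card : ℝ) := by
    exact_mod_cast hcard
  have h2 := XX_card (L := L) (by omega) hq A i hi0 hK
  linarith

end Pairs


theorem nice_pair_zero (L q : ℕ) (hL : 8 ≤ L) (A : Finset (Fin q)) (i : ℕ) (hi : i ≤ 2) :
    Nat.card {p : Conf L q × Conf L q //
      NicePair L q A p.1 p.2 ∧ max (Ham L q p.1) (Ham L q p.2) = 2 * L + i} = 0 := by
  have : NeZero L := ⟨by omega⟩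
  have : IsEmpty {p : Conf L q × Conf L q //
      NicePair L q A p.1 p.2 ∧ max (Ham L q p.1) (Ham L q p.2) = 2 * L + i} := by
    refine ⟨fun p => ?_⟩
    have := part_one hL A p.1.1 p.1.2 p.2.1
    rw [p.2.2] at this
    omega
  exact Nat.card_of_isEmpty

/-- Proposition 9.3 (hexagonal lattice): for a proper partition `(A,B)` of `Ω`, let
`U_i` be the number of nice pairs `(σ,ζ)` with `max{H(σ), H(ζ)} = 2L+i`. Then
(1) `U_i = 0` for `i ≤ 2`, and (2) there is `C = C(q) > 0` with `U_i ≤ (CL)^{3i+1}`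
for all `i < (√6 - 2)L - 1`. -/
theorem nice_pair_count (q : ℕ) (hq : 2 ≤ q) :
    ∃ C : ℝ, 0 < C ∧ ∀ L : ℕ, 8 ≤ L → ∀ A B : Finset (Fin q),
      A.Nonempty → B.Nonempty → Disjoint A B → A ∪ B = Finset.univ →
      (∀ i : ℕ, i ≤ 2 →
        Nat.card {p : Conf L q × Conf L q //
          NicePair L q A p.1 p.2 ∧ max (Ham L q p.1) (Ham L q p.2) = 2 * L + i} = 0) ∧
      (∀ i : ℕ, (i : ℝ) < (Real.sqrt 6 - 2) * (L : ℝ) - 1 →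
        (Nat.card {p : Conf L q × Conf L q //
            NicePair L q A p.1 p.2 ∧ max (Ham L q p.1) (Ham L q p.2) = 2 * L + i} : ℝ) ≤
          (C * (L : ℝ)) ^ (3 * i + 1)) := by
  have hq' : (1 : ℝ) ≤ q := by exact_mod_cast (by omega : 1 ≤ q)
  refine ⟨72 * q ^ 3, by positivity, ?_⟩
  intro L hL A B _ _ _ _
  refine ⟨fun i hi => nice_pair_zero L q hL A i hi, ?_⟩
  intro i hi
  have hL0 : (0 : ℝ) < L := by exact_mod_cast (by omega : 0 < L)
  by_cases hi2 : i ≤ 2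
  · rw [nice_pair_zero L q hL A i hi2]
    simp only [Nat.cast_zero]
    positivity
  have hne : NeZero L := ⟨by omega⟩
  have hsq : (2 * L + i + 1) ^ 2 < 6 * L ^ 2 := by
    have h6 : (Real.sqrt 6) ^ 2 = 6 := Real.sq_sqrt (by norm_num)
    have h1 : (2 * L + i + 1 : ℝ) < Real.sqrt 6 * L := by linarith
    have h2 : (2 * L + i + 1 : ℝ) ^ 2 < (Real.sqrt 6 * L) ^ 2 :=
      pow_lt_pow_left₀ h1 (by positivity) (by norm_num)
    rw [mul_pow, h6] at h2
    exact_mod_cast h2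
  set D : ℝ := 36 * q ^ 3 * L with hD
  have hD0 : 0 < D := by positivity
  have hK : 12 * (q : ℝ) ^ 3 * L ^ 3 ≤ D ^ 3 := by
    have a : (1 : ℝ) ≤ q ^ 3 := one_le_pow₀ hq'
    have b : (1 : ℝ) ≤ (q ^ 3) ^ 2 := one_le_pow₀ a
    have c : (q : ℝ) ^ 3 ≤ (q ^ 3) ^ 3 := by nlinarith
    calc 12 * (q : ℝ) ^ 3 * L ^ 3 ≤ 12 * ((q : ℝ) ^ 3) ^ 3 * (L : ℝ) ^ 3 := by gcongr
      _ ≤ 36 ^ 3 * ((q : ℝ) ^ 3) ^ 3 * (L : ℝ) ^ 3 := by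
          gcongr
          norm_num
      _ = D ^ 3 := by rw [hD]; ring
  have h := part_two hL (by omega) A i (by omega) hsq hK
  have hp : ((i : ℝ) + 1) ≤ 2 ^ (3 * i + 1) := by
    have : i + 1 < 2 ^ (i + 1) := Nat.lt_two_pow_self
    have h3 : 2 ^ (i + 1) ≤ 2 ^ (3 * i + 1) := Nat.pow_le_pow_right (by norm_num) (by omega)
    exact_mod_cast this.le.trans h3
  calc _ ≤ 36 * q ^ 3 * L * (D ^ 3) ^ i * (i + 1) := h
    _ = D ^ (3 * i + 1) * (i + 1) := by rw [← pow_mul, pow_succ, hD]; ring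
    _ ≤ D ^ (3 * i + 1) * 2 ^ (3 * i + 1) := by gcongr
    _ = (72 * q ^ 3 * L) ^ (3 * i + 1) := by rw [← mul_pow, hD]; ring

end IsingHex
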